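/- arXiv:1406.0042 — 3 statements merged into one kernel-verified Lean document; each statement's English description precedes it below -/
import Mathlib

section
/- Let 0 < R ≤ ∞, let I = [0,R) or I = (-R,R), and suppose f : I → ℝ is k times continuously differentiable on I, where 1 ≤ k < n are integers. Then: (1) f[a·1_{n×n} + u uᵀ] ∈ S_n^k for all a ∈ I and all u ∈ ℝ^n with a + u_i u_j ∈ I for all i, j, if and only if f agrees on I with a polynomial of degree at most k−1. (2) If I = [0,R), then f[a·1_{n×n} + u uᵀ] ∈ P_n^k for all a ∈ [0,R) and all u ∈ ℝ^n with a + u_i u_j ∈ I for all i, j, if and only if f agrees on I with a polynomial of degree at most k−1 having nonnegative coefficients; moreover, if k ≤ n−3, this equivalence in (2) holds for arbitrary f : [0,R) → ℝ, without the differentiability assumption. -/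
open Matrix Set

/-- Padding: a principal matrix on a small index type has vanishing determinant. -/
lemma sr_det_zero {n k : ℕ} {I : Set ℝ} {f : ℝ → ℝ} {a : ℝ}
    (h : ∀ u : Fin n → ℝ, (∀ i j, a + u i * u j ∈ I) →
      (Matrix.of fun i j => f (a + u i * u j)).rank ≤ k)
    {ι : Type} [Fintype ι] [DecidableEq ι] (h1 : k < Fintype.card ι) (h2 : Fintype.card ι ≤ n)
    (u : ι → ℝ) (hu : ∀ i j, a + u i * u j ∈ I) :
    (Matrix.of fun i j => f (a + u i * u j)).det = 0 := by
  by_contra hne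
  have hnon : Nonempty ι := Fintype.card_pos_iff.mp (by omega)
  obtain ⟨e⟩ : Nonempty (ι ↪ Fin n) := Function.Embedding.nonempty_of_card_le (by simpa using h2)
  have hr := h (u ∘ Function.invFun e) (fun i j => hu _ _)
  have hs := Matrix.rank_submatrix_le (Matrix.of fun i j =>
    f (a + (u ∘ Function.invFun e) i * (u ∘ Function.invFun e) j)) e e
  have heq : (Matrix.of fun i j =>
    f (a + (u ∘ Function.invFun e) i * (u ∘ Function.invFun e) j)).submatrix e e =
      Matrix.of fun i j => f (a + u i * u j) := by
    ext i j
    simp [Function.leftInverse_invFun e.injective _]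
  rw [heq, Matrix.rank_of_isUnit _ ((Matrix.isUnit_iff_isUnit_det _).mpr (isUnit_iff_ne_zero.mpr hne))] at hs
  omega

lemma sr_psd {n : ℕ} {I : Set ℝ} {f : ℝ → ℝ} {a : ℝ}
    (h : ∀ u : Fin n → ℝ, (∀ i j, a + u i * u j ∈ I) →
      (Matrix.of fun i j => f (a + u i * u j)).PosSemidef)
    {ι : Type} [Fintype ι] [Nonempty ι] (h2 : Fintype.card ι ≤ n)
    (u : ι → ℝ) (hu : ∀ i j, a + u i * u j ∈ I) :
    (Matrix.of fun i j => f (a + u i * u j)).PosSemidef := by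
  obtain ⟨e⟩ : Nonempty (ι ↪ Fin n) := Function.Embedding.nonempty_of_card_le (by simpa using h2)
  have hr := (h (u ∘ Function.invFun e) (fun i j => hu _ _)).submatrix e
  have heq : (Matrix.of fun i j =>
    f (a + (u ∘ Function.invFun e) i * (u ∘ Function.invFun e) j)).submatrix e e =
      Matrix.of fun i j => f (a + u i * u j) := by
    ext i j
    simp [Function.leftInverse_invFun e.injective _]
  rwa [heq] at hr

/-- Iterated Rolle. -/
lemma sr_rolle (p q : ℝ) : ∀ (N : ℕ) (φ : ℕ → ℝ → ℝ) (z : ℕ → ℝ),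
    (∀ m < N, ∀ x ∈ Icc p q, HasDerivAt (φ m) (φ (m+1) x) x) →
    (∀ i < N, z i < z (i+1)) → (∀ i ≤ N, z i ∈ Icc p q ∧ φ 0 (z i) = 0) →
    ∀ m ≤ N, ∃ ξ ∈ Icc p q, φ m ξ = 0 := by
  intro N
  induction N with
  | zero =>
    intro φ z _ _ hz m hm
    obtain rfl : m = 0 := by omega
    exact ⟨z 0, hz 0 le_rfl⟩
  | succ N ih =>
    intro φ z hd hlt hz m hm
    rcases m with _ | m
    · exact ⟨z 0, hz 0 (by omega)⟩
    have hex : ∀ i, ∃ c, i ≤ N → c ∈ Ioo (z i) (z (i+1)) ∧ φ 1 c = 0 := by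
      intro i
      by_cases hi : i ≤ N
      · have hsub : Icc (z i) (z (i+1)) ⊆ Icc p q :=
          Icc_subset_Icc (hz i (by omega)).1.1 (hz (i+1) (by omega)).1.2
        obtain ⟨c, hc, hc0⟩ := exists_hasDerivAt_eq_zero (f := φ 0) (f' := φ 1)
          (hlt i (by omega))
          (fun x hx => (hd 0 (by omega) x (hsub hx)).continuousAt.continuousWithinAt)
          (by rw [(hz i (by omega)).2, (hz (i+1) (by omega)).2])
          (fun x hx => hd 0 (by omega) x (hsub (Ioo_subset_Icc_self hx)))
        exact ⟨c, fun _ => ⟨hc, hc0⟩⟩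
      · exact ⟨0, fun h => absurd h hi⟩
    choose c hc using hex
    refine ih (fun m => φ (m+1)) c (fun m hm x hx => hd (m+1) (by omega) x hx) ?_ ?_ m (by omega)
    · intro i hi
      exact ((hc i (by omega)).1.2).trans (hc (i+1) (by omega)).1.1
    · intro i hi
      refine ⟨⟨?_, ?_⟩, (hc i hi).2⟩
      · exact (hz i (by omega)).1.1.trans (hc i hi).1.1.le
      · exact (hc i hi).1.2.le.trans (hz (i+1) (by omega)).1.2

open Filter Topology in
lemma sr_step1 {J : Set ℝ} (hJ : IsOpen J) {k : ℕ} {F : ℕ → ℝ → ℝ}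
    (hd : ∀ m < k, ∀ x ∈ J, HasDerivAt (F m) (F (m+1) x) x)
    (hc : ∀ m ≤ k, ContinuousOn (F m) J)
    {a : ℝ} (ha : a ∈ J)
    (hdet : ∀ u : Fin (k+1) → ℝ, (∀ i j, a + u i * u j ∈ J) →
      (Matrix.of fun i j => F 0 (a + u i * u j)).det = 0) :
    ∃ m ≤ k, F m a = 0 := by
  by_contra! hne
  obtain ⟨r, hr, hball⟩ := Metric.isOpen_iff.mp hJ a ha
  set w : ℕ → ℝ := fun j => (j : ℝ) + 1 with hw
  set B : ℝ := (k : ℝ) + 1 with hB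
  have hBpos : 0 < B := by positivity
  have hwpos : ∀ j, 0 < w j := fun j => by simp only [hw]; positivity
  have hwB : ∀ j ≤ k, w j ≤ B := fun j hj => by
    simp only [hw, hB]; gcongr
  have hw1 : ∀ j, 1 ≤ w j := fun j => by simp [hw]
  have hin : ∀ s, 0 < s → s < r / B^2 → ∀ x y, x ∈ Icc 1 B → y ∈ Icc 1 B → a + s * x * y ∈ J := by
    intro s hs hs' x y hx hy
    apply hball
    rw [Metric.mem_ball, Real.dist_eq, add_sub_cancel_left]
    have hx0 : 0 < x := by linarith [hx.1]
    have hy0 : 0 < y := by linarith [hy.1]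
    rw [abs_of_pos (by positivity)]
    calc s * x * y ≤ s * B * B := by
          gcongr
          exacts [hx.2, hy.2]
      _ = s * B^2 := by ring
      _ < r := by rwa [lt_div_iff₀ (by positivity)] at hs'
  have key : ∀ s, ∃ ξ : Fin (k+1) → ℝ, 0 < s → s < r / B^2 →
      (∀ m, ξ m ∈ Icc 1 B) ∧
      (Matrix.of fun m j : Fin (k+1) => F m (a + s * ξ m * w j) * w j ^ (m:ℕ)).det = 0 := by
    intro s
    by_cases hs : 0 < s ∧ s < r / B^2
    swap
    · exact ⟨0, fun h1 h2 => absurd ⟨h1, h2⟩ hs⟩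
    obtain ⟨hs, hs'⟩ := hs
    have hwI : ∀ j : Fin (k+1), w j ∈ Icc 1 B := fun j => ⟨hw1 j, hwB j (by omega)⟩
    have hprod : ∀ i j : Fin (k+1), a + (Real.sqrt s * w i) * (Real.sqrt s * w j)
        = a + s * w i * w j := by
      intro i j
      have := Real.mul_self_sqrt hs.le
      linear_combination (w i * w j) * this
    have h0 := hdet (fun i => Real.sqrt s * w i) (fun i j => by
      rw [hprod]; exact hin s hs hs' _ _ (hwI i) (hwI j))
    obtain ⟨c, hc0, hcM⟩ := Matrix.exists_mulVec_eq_zero_iff.mpr h0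
    have hz : ∀ i : Fin (k+1), ∑ j : Fin (k+1), F 0 (a + s * w i * w j) * c j = 0 := by
      intro i
      have := congrFun hcM i
      simp only [Matrix.mulVec, dotProduct, Matrix.of_apply, hprod] at this
      simpa using this
    have hro := sr_rolle 1 B k
      (fun m x => ∑ j : Fin (k+1), F m (a + s * x * w j) * (s * w j)^m * c j) w ?_ ?_ ?_
    · have hro' : ∀ m : Fin (k+1), ∃ ξ ∈ Icc 1 B,
          ∑ j : Fin (k+1), F m (a + s * ξ * w j) * (s * w j)^(m:ℕ) * c j = 0 :=
        fun m => hro m (by omega)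
      choose ξ hξ hξ0 using hro'
      refine ⟨ξ, fun _ _ => ⟨hξ, ?_⟩⟩
      apply Matrix.exists_mulVec_eq_zero_iff.mp
      refine ⟨c, hc0, ?_⟩
      ext m
      have h := hξ0 m
      simp only [Matrix.mulVec, dotProduct, Matrix.of_apply, Pi.zero_apply]
      have hsm : s ^ (m:ℕ) ≠ 0 := by positivity
      apply mul_left_cancel₀ hsm
      rw [mul_zero, ← h, Finset.mul_sum]
      refine Finset.sum_congr rfl fun j _ => ?_
      rw [mul_pow]; ring
    · intro m hm x hx
      have hh : ∀ j : Fin (k+1), HasDerivAt (fun x => F m (a + s * x * w j) * (s * w j)^m * c j)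
          (F (m+1) (a + s * x * w j) * (s * w j)^(m+1) * c j) x := by
        intro j
        have h1 : HasDerivAt (fun x => a + s * x * w j) (s * w j) x := by
          have := (((hasDerivAt_id x).const_mul s).mul_const (w j)).const_add a
          simpa using this
        have h2 := (hd m hm _ (hin s hs hs' x (w j) hx (hwI j))).comp x h1
        have h3 := (h2.mul_const ((s * w j)^m)).mul_const (c j)
        refine h3.congr_deriv ?_
        ring
      exact HasDerivAt.fun_sum fun j _ => hh j
    · intro i _
      simp [hw]
    · intro i hi
      refine ⟨⟨hw1 i, hwB i hi⟩, ?_⟩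
      have := hz ⟨i, by omega⟩
      simpa using this
  choose ξ hξ using key
  have hev : ∀ᶠ s in 𝓝[>] (0:ℝ), 0 < s ∧ s < r / B^2 := by
    have := Ioo_mem_nhdsGT (show (0:ℝ) < r / B^2 by positivity)
    filter_upwards [this] with s hs using hs
  have hlim : Tendsto (fun s => (Matrix.of fun m j : Fin (k+1) =>
      F m (a + s * ξ s m * w j) * w j ^ (m:ℕ))) (𝓝[>] (0:ℝ))
      (𝓝 (Matrix.of fun m j : Fin (k+1) => F m a * w j ^ (m:ℕ))) := by
    refine tendsto_pi_nhds.mpr fun m => tendsto_pi_nhds.mpr fun j => ?_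
    simp only [Matrix.of_apply]
    refine Tendsto.mul_const _ ?_
    have hca : ContinuousAt (F m) a := (hc m (by omega)).continuousAt (hJ.mem_nhds ha)
    refine hca.tendsto.comp ?_
    have h0 : Tendsto (fun s => s * ξ s m * w j) (𝓝[>] (0:ℝ)) (𝓝 0) := by
      have hb : Tendsto (fun s : ℝ => s * B * w j) (𝓝[>] (0:ℝ)) (𝓝 0) := by
        have : Continuous (fun s : ℝ => s * B * w j) := by fun_prop
        have := (this.tendsto 0).mono_left (nhdsWithin_le_nhds (s := Ioi 0))
        simpa using this
      refine squeeze_zero' ?_ ?_ hb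
      · filter_upwards [hev] with s hs
        have := ((hξ s hs.1 hs.2).1 m).1
        have := hwpos j
        have := hs.1
        positivity
      · filter_upwards [hev] with s hs
        have := ((hξ s hs.1 hs.2).1 m).2
        have := (hwpos j).le
        have := hs.1
        gcongr
    simpa using h0.const_add a
  have hdl := ((Continuous.matrix_det continuous_id).tendsto _).comp hlim
  have hd0 : (Matrix.of fun m j : Fin (k+1) => F m a * w j ^ (m:ℕ)).det = 0 := by
    refine tendsto_nhds_unique (hdl.congr' ?_) (tendsto_const_nhds (x := (0:ℝ)))
    filter_upwards [hev] with s hs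
    exact (hξ s hs.1 hs.2).2
  have hV := Matrix.det_mul_column (fun m : Fin (k+1) => F m a)
    (Matrix.vandermonde (fun j : Fin (k+1) => w j))ᵀ
  have heq : (Matrix.of fun m j : Fin (k+1) => F m a * w j ^ (m:ℕ)) =
     Matrix.of fun i j : Fin (k+1) => F i a * (Matrix.vandermonde (fun j : Fin (k+1) => w j))ᵀ i j := by
    ext i j; simp [Matrix.vandermonde_apply]
  rw [← heq, hd0, Matrix.det_transpose] at hV
  have h1 : (∏ i : Fin (k+1), F i a) ≠ 0 := Finset.prod_ne_zero_iff.mpr fun i _ => hne i (by omega)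
  have h2 : (Matrix.vandermonde (fun j : Fin (k+1) => w j)).det ≠ 0 := by
    rw [Matrix.det_vandermonde_ne_zero_iff]
    intro i j hij
    simp only [hw] at hij
    ext
    exact_mod_cast add_right_cancel hij
  exact mul_ne_zero h1 h2 hV.symm

lemma sr_step2 {J : Set ℝ} (hJ : IsOpen J) {k : ℕ} {F : ℕ → ℝ → ℝ}
    (hd : ∀ m < k, ∀ x ∈ J, HasDerivAt (F m) (F (m+1) x) x)
    (hc : ∀ m ≤ k, ContinuousOn (F m) J)
    (h0 : ∀ a ∈ J, ∃ m ≤ k, F m a = 0) : ∀ x ∈ J, F k x = 0 := by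
  by_contra! hx
  have key : ∀ d ≤ k, ∃ U ⊆ J, IsOpen U ∧ U.Nonempty ∧
      ∀ m, k - d ≤ m → m ≤ k → ∀ x ∈ U, F m x ≠ 0 := by
    intro d
    induction d with
    | zero =>
      intro _
      obtain ⟨x, hx, hxk⟩ := hx
      refine ⟨J ∩ F k ⁻¹' {0}ᶜ, inter_subset_left,
        (hc k le_rfl).isOpen_inter_preimage hJ isOpen_compl_singleton, ⟨x, hx, hxk⟩, ?_⟩
      intro m h1 h2 y hy
      obtain rfl : m = k := by omega
      exact hy.2
    | succ d ih =>
      intro hdk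
      obtain ⟨U, hUJ, hU, ⟨y, hy⟩, hUn⟩ := ih (by omega)
      have hex : ∃ x ∈ U, F (k - (d+1)) x ≠ 0 := by
        by_contra! hz
        have h1 := hd (k - (d+1)) (by omega) y (hUJ hy)
        have h2 : HasDerivAt (F (k - (d+1))) 0 y := by
          refine (hasDerivAt_const y (0:ℝ)).congr_of_eventuallyEq ?_
          filter_upwards [hU.mem_nhds hy] with x hx using hz x hx
        exact hUn (k - (d+1) + 1) (by omega) (by omega) y hy (h1.unique h2)
      obtain ⟨x, hx, hxn⟩ := hex
      refine ⟨U ∩ F (k - (d+1)) ⁻¹' {0}ᶜ, inter_subset_left.trans hUJ,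
        ((hc _ (by omega)).mono hUJ).isOpen_inter_preimage hU isOpen_compl_singleton,
        ⟨x, hx, hxn⟩, ?_⟩
      intro m h1 h2 z hz
      by_cases hm : m = k - (d+1)
      · subst hm; exact hz.2
      · exact hUn m (by omega) h2 z hz.1
  obtain ⟨U, hUJ, _, ⟨y, hy⟩, hUn⟩ := key k le_rfl
  obtain ⟨m, hm, hm0⟩ := h0 y (hUJ hy)
  exact hUn m (by omega) hm y hy hm0

lemma sr_step3 {J : Set ℝ} (hJ : IsOpen J) (hJc : IsPreconnected J) : ∀ (k : ℕ) (F : ℕ → ℝ → ℝ),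
    (∀ m < k, ∀ x ∈ J, HasDerivAt (F m) (F (m+1) x) x) →
    (∀ x ∈ J, F k x = 0) → ∃ p : Polynomial ℝ, p.degree < k ∧ ∀ x ∈ J, F 0 x = p.eval x := by
  intro k
  induction k with
  | zero => 
    intro F _ h0
    exact ⟨0, by simp, fun x hx => by simp [h0 x hx]⟩
  | succ k ih =>
    intro F hd h0
    obtain ⟨q, hq, hqe⟩ := ih (fun m => F (m+1)) (fun m hm => hd (m+1) (by omega)) h0
    set Q : Polynomial ℝ := ∑ i ∈ Finset.range k,
      Polynomial.C (q.coeff i / (i+1)) * Polynomial.X^(i+1) with hQ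
    have hQd : Polynomial.derivative Q = q := by
      by_cases hq0 : q = 0
      · simp [hQ, hq0]
      conv_rhs => rw [q.as_sum_range' k ((Polynomial.natDegree_lt_iff_degree_lt hq0).mpr hq)]
      rw [hQ, Polynomial.derivative_sum]
      refine Finset.sum_congr rfl fun i _ => ?_
      rw [Polynomial.derivative_C_mul_X_pow, ← Polynomial.C_mul_X_pow_eq_monomial]
      congr 2
      push_cast
      field_simp
    have hQdeg : Q.degree < (k+1 : ℕ) := by
      rw [← Polynomial.mem_degreeLT]
      refine Submodule.sum_mem _ fun i hi => ?_
      rw [Polynomial.mem_degreeLT]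
      refine (Polynomial.degree_C_mul_X_pow_le _ _).trans_lt ?_
      have := Finset.mem_range.mp hi
      exact_mod_cast (by omega : i + 1 < k + 1)
    obtain ⟨c, hc⟩ := hJ.exists_is_const_of_deriv_eq_zero (f := fun x => F 0 x - Q.eval x) hJc
      (fun x hx => ((hd 0 (by omega) x hx).sub (Q.hasDerivAt x)).differentiableAt.differentiableWithinAt)
      (fun x hx => by
        refine ((hd 0 (by omega) x hx).sub (Q.hasDerivAt x)).deriv.trans ?_
        rw [hQd]
        simp [hqe x hx])
    refine ⟨Q + Polynomial.C c, ?_, fun x hx => ?_⟩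
    · rw [← Polynomial.mem_degreeLT] at hQdeg ⊢
      refine Submodule.add_mem _ hQdeg ?_
      rw [Polynomial.mem_degreeLT]
      exact Polynomial.degree_C_le.trans_lt (by exact_mod_cast Nat.succ_pos k)
    · have := hc x hx
      simp
      linarith

lemma sr_main {J : Set ℝ} (hJ : IsOpen J) (hJc : IsPreconnected J) {k : ℕ} (hk : 1 ≤ k) {f : ℝ → ℝ}
    (hf : ContDiffOn ℝ k f J)
    (hdet : ∀ a ∈ J, ∀ u : Fin (k+1) → ℝ, (∀ i j, a + u i * u j ∈ J) →
      (Matrix.of fun i j => f (a + u i * u j)).det = 0) :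
    ∃ p : Polynomial ℝ, p.natDegree ≤ k - 1 ∧ ∀ x ∈ J, f x = p.eval x := by
  have hd : ∀ m < k, ∀ x ∈ J, HasDerivAt (iteratedDerivWithin m f J)
      (iteratedDerivWithin (m+1) f J x) x := by
    intro m hm x hx
    have h1 := hf.differentiableOn_iteratedDerivWithin (m := m) (by exact_mod_cast hm)
      hJ.uniqueDiffOn
    have h2 := (h1 x hx).differentiableAt (hJ.mem_nhds hx)
    rw [iteratedDerivWithin_succ, derivWithin_of_isOpen hJ hx]
    exact h2.hasDerivAt
  have hc : ∀ m ≤ k, ContinuousOn (iteratedDerivWithin m f J) J := fun m hm =>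
    hf.continuousOn_iteratedDerivWithin (by exact_mod_cast hm) hJ.uniqueDiffOn
  have h0 := sr_step2 hJ hd hc (fun a ha => sr_step1 hJ hd hc ha (by
    simpa using hdet a ha))
  obtain ⟨p, hp, hpe⟩ := sr_step3 hJ hJc k (fun m => iteratedDerivWithin m f J) hd h0
  refine ⟨p, ?_, by simpa using hpe⟩
  by_cases hp0 : p = 0
  · simp [hp0]
  · have := (Polynomial.natDegree_lt_iff_degree_lt hp0).mpr hp
    omega

lemma sr_taylor {k n : ℕ} (hk : 1 ≤ k) {p : Polynomial ℝ} (hp : p.natDegree ≤ k - 1) (a : ℝ)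
    (u : Fin n → ℝ) :
    (Matrix.of fun i j => p.eval (a + u i * u j)) =
      (Matrix.of fun (i : Fin n) (m : Fin k) => u i ^ (m:ℕ)) *
        Matrix.diagonal (fun m : Fin k => (Polynomial.taylor a p).coeff m) *
        (Matrix.of fun (i : Fin n) (m : Fin k) => u i ^ (m:ℕ))ᴴ := by
  ext i j
  rw [Matrix.mul_apply]
  simp only [Matrix.of_apply, Matrix.mul_diagonal, Matrix.conjTranspose_apply, star_trivial]
  rw [add_comm a, ← Polynomial.taylor_eval, Polynomial.eval_eq_sum_range' (n := k)
    (by rw [Polynomial.natDegree_taylor]; omega),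
    ← Fin.sum_univ_eq_sum_range (fun m => (Polynomial.taylor a p).coeff m * (u i * u j)^m)]
  refine Finset.sum_congr rfl fun m _ => ?_
  rw [mul_pow]; ring

lemma sr_rank {k n : ℕ} (hk : 1 ≤ k) {p : Polynomial ℝ} (hp : p.natDegree ≤ k - 1) (a : ℝ)
    (u : Fin n → ℝ) : (Matrix.of fun i j => p.eval (a + u i * u j)).rank ≤ k := by
  rw [sr_taylor hk hp, Matrix.mul_assoc]
  exact (Matrix.rank_mul_le_left _ _).trans (Matrix.rank_le_width _)

lemma sr_pos {k n : ℕ} (hk : 1 ≤ k) {p : Polynomial ℝ} (hp : p.natDegree ≤ k - 1)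
    (hc : ∀ m, 0 ≤ p.coeff m) {a : ℝ} (ha : 0 ≤ a)
    (u : Fin n → ℝ) : (Matrix.of fun i j => p.eval (a + u i * u j)).PosSemidef := by
  rw [sr_taylor hk hp]
  refine (Matrix.PosSemidef.diagonal fun m => ?_).mul_mul_conjTranspose_same _
  simp only [Pi.zero_apply]
  rw [Polynomial.taylor_coeff, Polynomial.eval_eq_sum_range]
  refine Finset.sum_nonneg fun i _ => ?_
  rw [Polynomial.hasseDeriv_coeff]
  have := hc (i + m)
  positivity

lemma sr_coeff {k n : ℕ} (hkn : k < n) {p : Polynomial ℝ} (hp : p.natDegree ≤ k - 1)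
    {I : Set ℝ} {f : ℝ → ℝ} (hfp : ∀ x ∈ I, f x = p.eval x)
    {u : Fin n → ℝ} (hui : Function.Injective u)
    (hu : ∀ i j, 0 + u i * u j ∈ I)
    (hpsd : (Matrix.of fun i j => f (0 + u i * u j)).PosSemidef) (m : ℕ) : 0 ≤ p.coeff m := by
  by_cases hm : n ≤ m
  · rw [Polynomial.coeff_eq_zero_of_natDegree_lt (by omega)]
  push Not at hm
  have heq : (Matrix.of fun i j => f (0 + u i * u j)) =
      Matrix.of fun i j => p.eval (0 + u i * u j) := by
    ext i j; simp only [Matrix.of_apply]; exact hfp _ (hu i j)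
  rw [heq, sr_taylor (k := n) (by omega) (by omega)] at hpsd
  have hV : IsUnit (Matrix.vandermonde u).det :=
    isUnit_iff_ne_zero.mpr (Matrix.det_vandermonde_ne_zero_iff.mpr hui)
  have hVe : (Matrix.of fun (i : Fin n) (m : Fin n) => u i ^ (m:ℕ)) = Matrix.vandermonde u := by
    ext i j; simp [Matrix.vandermonde_apply]
  rw [hVe] at hpsd
  have h2 := hpsd.mul_mul_conjTranspose_same (Matrix.vandermonde u)⁻¹
  have h3 : (Matrix.vandermonde u)⁻¹ * (Matrix.vandermonde u *
      Matrix.diagonal (fun m : Fin n => (Polynomial.taylor 0 p).coeff m) *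
      (Matrix.vandermonde u)ᴴ) * ((Matrix.vandermonde u)⁻¹)ᴴ =
      Matrix.diagonal (fun m : Fin n => (Polynomial.taylor 0 p).coeff m) := by
    rw [Matrix.mul_assoc, Matrix.mul_assoc, Matrix.mul_assoc, ← Matrix.conjTranspose_mul,
      Matrix.nonsing_inv_mul _ hV, Matrix.conjTranspose_one, Matrix.mul_one,
      ← Matrix.mul_assoc, Matrix.nonsing_inv_mul _ hV, Matrix.one_mul]
  rw [h3, Matrix.posSemidef_diagonal_iff] at h2
  simpa using h2 ⟨m, hm⟩

open Filter Topology in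
lemma sr_cont {J : Set ℝ} (hJ : IsOpen J) (hJo : J.OrdConnected) (hJp : ∀ x ∈ J, 0 < x) {g : ℝ → ℝ}
    (hpos : ∀ x ∈ J, 0 ≤ g x) (hmono : MonotoneOn g J)
    (hmul : ∀ x y, 0 < x → 0 < y → x^2 ∈ J → y^2 ∈ J → g (x*y)^2 ≤ g (x^2) * g (y^2)) :
    ContinuousOn g J := by
  intro c hc
  refine ContinuousAt.continuousWithinAt ?_
  obtain ⟨l, r, ⟨hlc, hcr⟩, hlr⟩ := mem_nhds_iff_exists_Ioo_subset.mp (hJ.mem_nhds hc)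
  have hc0 := hJp c hc
  -- one-sided limits
  have hR := MonotoneOn.tendsto_nhdsWithin_Ioo_right (α := ℝ) (f := g) (x := c) (y := r)
    (nonempty_Ioo.mpr hcr)
    (hmono.mono fun x hx => hlr ⟨hlc.trans hx.1, hx.2⟩)
    ⟨0, by rintro _ ⟨x, hx, rfl⟩; exact hpos x (hlr ⟨hlc.trans hx.1, hx.2⟩)⟩
  have hL := MonotoneOn.tendsto_nhdsWithin_Ioo_left (α := ℝ) (f := g) (x := c) (y := l)
    (nonempty_Ioo.mpr hlc)
    (hmono.mono fun x hx => hlr ⟨hx.1, hx.2.trans hcr⟩)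
    ⟨g c, by rintro _ ⟨x, hx, rfl⟩; exact hmono (hlr ⟨hx.1, hx.2.trans hcr⟩) hc hx.2.le⟩
  set R0 := sInf (g '' Ioo c r)
  set L0 := sSup (g '' Ioo l c)
  have hRev : ∀ᶠ x in 𝓝[>] c, x ∈ J ∧ c < x := by
    filter_upwards [Ioo_mem_nhdsGT hcr] with x hx using ⟨hlr ⟨hlc.trans hx.1, hx.2⟩, hx.1⟩
  have hLev : ∀ᶠ x in 𝓝[<] c, x ∈ J ∧ x < c := by
    filter_upwards [Ioo_mem_nhdsLT hlc] with x hx using ⟨hlr ⟨hx.1, hx.2.trans hcr⟩, hx.2⟩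
  have hcR : g c ≤ R0 := ge_of_tendsto hR (by
    filter_upwards [hRev] with x hx using hmono hc hx.1 hx.2.le)
  have hLc : L0 ≤ g c := le_of_tendsto hL (by
    filter_upwards [hLev] with x hx using hmono hx.1 hc hx.2.le)
  have hL0 : 0 ≤ L0 := ge_of_tendsto hL (by
    filter_upwards [hLev] with x hx using hpos x hx.1)
  have hgc := hpos c hc
  have hmul' : ∀ z w, z ∈ J → w ∈ J → g (Real.sqrt z * Real.sqrt w)^2 ≤ g z * g w := by
    intro z w hz hw
    have hz0 := hJp z hz
    have hw0 := hJp w hw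
    have := hmul (Real.sqrt z) (Real.sqrt w) (Real.sqrt_pos.mpr hz0) (Real.sqrt_pos.mpr hw0)
      (by rwa [Real.sq_sqrt hz0.le]) (by rwa [Real.sq_sqrt hw0.le])
    rwa [Real.sq_sqrt hz0.le, Real.sq_sqrt hw0.le] at this
  -- right continuity
  have hRc : R0 = g c := by
    have hs : Tendsto (fun z => Real.sqrt c * Real.sqrt z) (𝓝[>] c) (𝓝[>] c) := by
      refine tendsto_nhdsWithin_of_tendsto_nhds_of_eventually_within _ ?_ ?_
      · have : Continuous (fun z => Real.sqrt c * Real.sqrt z) := by fun_prop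
        have := (this.tendsto c).mono_left (nhdsWithin_le_nhds (s := Ioi c))
        rwa [Real.mul_self_sqrt hc0.le] at this
      · filter_upwards [hRev] with z hz
        have h1 : Real.sqrt c < Real.sqrt z := Real.sqrt_lt_sqrt hc0.le hz.2
        have h2 := Real.mul_self_sqrt hc0.le
        have h3 := Real.sqrt_pos.mpr hc0
        show c < _
        nlinarith
    have h1 := (hR.comp hs).pow 2
    have h2 := hR.const_mul (g c)
    have h3 : R0^2 ≤ g c * R0 := le_of_tendsto_of_tendsto h1 h2 (by
      filter_upwards [hRev] with z hz using hmul' c z hc hz.1)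
    nlinarith
  have hLc' : L0 = g c := by
    have hs : Tendsto (fun z => c * c / z) (𝓝[<] c) (𝓝[>] c) := by
      refine tendsto_nhdsWithin_of_tendsto_nhds_of_eventually_within _ ?_ ?_
      · have : ContinuousAt (fun z => c * c / z) c := by
          fun_prop (disch := exact hc0.ne')
        have := this.tendsto.mono_left (nhdsWithin_le_nhds (s := Iio c))
        rwa [mul_div_assoc, div_self hc0.ne', mul_one] at this
      · filter_upwards [hLev] with z hz
        have := hJp z hz.1
        show c < _
        rw [lt_div_iff₀ this]
        nlinarith [hz.2]
    have h1 := hL.mul (hR.comp hs)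
    have h3 : g c^2 ≤ L0 * R0 := ge_of_tendsto h1 (by
      filter_upwards [hLev, hs.eventually hRev] with z hz hz'
      have hz0 := hJp z hz.1
      have := hmul' z (c*c/z) hz.1 hz'.1
      rwa [← Real.sqrt_mul hz0.le, mul_div_cancel₀ _ hz0.ne', Real.sqrt_mul_self hc0.le] at this)
    nlinarith
  rw [continuousAt_iff_continuous_left'_right']
  constructor
  · rw [hLc'] at hL; exact hL
  · rw [hRc] at hR; exact hR

lemma sr_fe {X : Set ℝ} {g : ℝ → ℝ} {k : ℕ}
    (hdet : ∀ (r : ℕ), k < r → r ≤ k + 2 → ∀ (ι : Type) [Fintype ι] [DecidableEq ι],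
      Fintype.card ι = r → ∀ u : ι → ℝ, (∀ i, u i ∈ X) →
      (Matrix.of fun i j => g (u i * u j)).det = 0) :
    ∃ (r : ℕ) (u : Fin r → ℝ), (∀ i, u i ∈ X) ∧
      (Matrix.of fun i j => g (u i * u j)).det ≠ 0 ∧
      ∀ x ∈ X, ∀ y ∈ X, g (x * y) = ∑ j, ∑ i, g (x * u i) *
        (Matrix.of fun i j => g (u i * u j))⁻¹ i j * g (u j * y) := by
  classical
  let P : ℕ → Prop := fun r => ∃ u : Fin r → ℝ, (∀ i, u i ∈ X) ∧
      (Matrix.of fun i j => g (u i * u j)).det ≠ 0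
  have hP0 : P 0 := ⟨fun i => i.elim0, fun i => i.elim0, by simp⟩
  have hP1 : ∀ r, k < r → r ≤ k + 2 → ¬ P r := by
    rintro r h1 h2 ⟨u, hu, hd⟩
    exact hd (hdet r h1 h2 (Fin r) (by simp) u hu)
  set r := Nat.findGreatest P (k+2) with hr
  have hPr : P r := Nat.findGreatest_spec (m := 0) (by omega) hP0
  have hrk : r ≤ k := by
    by_contra h
    exact hP1 r (by omega) (Nat.findGreatest_le _) hPr
  have hnP : ∀ s, r < s → s ≤ k + 2 → ¬ P s := fun s h1 h2 =>
    Nat.findGreatest_is_greatest h1 h2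
  obtain ⟨u, hu, hD⟩ := hPr
  refine ⟨r, u, hu, hD, ?_⟩
  set D := (Matrix.of fun i j => g (u i * u j)) with hDdef
  have hDu : IsUnit D.det := isUnit_iff_ne_zero.mpr hD
  have hDs : ∀ i j, D⁻¹ i j = D⁻¹ j i := by
    intro i j
    have : (D⁻¹)ᵀ = D⁻¹ := by
      rw [Matrix.transpose_nonsing_inv]
      congr 1
      ext i j
      simp [hDdef, mul_comm]
    exact congrFun (congrFun this j) i
  set T : ℝ → ℝ → ℝ := fun x y => g (x * y) - ∑ j, ∑ i, g (x * u i) * D⁻¹ i j * g (u j * y) with hT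
  have hTs : ∀ x y, T x y = T y x := by
    intro x y
    simp only [hT]
    rw [mul_comm x y]
    congr 1
    rw [Finset.sum_comm]
    refine Finset.sum_congr rfl fun i _ => Finset.sum_congr rfl fun j _ => ?_
    rw [hDs i j, mul_comm x, mul_comm y]
    ring
  have hS : ∀ (s : ℕ), 1 ≤ s → s ≤ 2 → ∀ v : Fin s → ℝ, (∀ i, v i ∈ X) →
      (Matrix.of fun i j => T (v i) (v j)).det = 0 := by
    intro s hs1 hs2 v hv
    have hz : (Matrix.of fun i j : Fin r ⊕ Fin s =>
        g (Sum.elim u v i * Sum.elim u v j)).det = 0 := by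
      by_contra hne
      refine hnP (r + s) (by omega) (by omega) ⟨Sum.elim u v ∘ finSumFinEquiv.symm, ?_, ?_⟩
      · intro i
        simp only [Function.comp]
        cases finSumFinEquiv.symm i with
        | inl a => exact hu a
        | inr a => exact hv a
      · rw [← Matrix.det_submatrix_equiv_self (finSumFinEquiv (m := r) (n := s))]
        convert hne using 2
        ext i j
        simp
    have hb : (Matrix.of fun i j : Fin r ⊕ Fin s => g (Sum.elim u v i * Sum.elim u v j)) =
        Matrix.fromBlocks D (Matrix.of fun i j => g (u i * v j))
          (Matrix.of fun i j => g (v i * u j)) (Matrix.of fun i j => g (v i * v j)) := by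
      ext i j
      cases i <;> cases j <;> simp [hDdef]
    let _ := Matrix.invertibleOfIsUnitDet D hDu
    rw [hb, Matrix.det_fromBlocks₁₁, Matrix.invOf_eq_nonsing_inv] at hz
    have h2 := (mul_eq_zero.mp hz).resolve_left hD
    convert h2 using 2
    ext i j
    simp [hT, Matrix.mul_apply, Finset.sum_mul]
  have hT0 : ∀ x ∈ X, T x x = 0 := by
    intro x hx
    have := hS 1 le_rfl (by omega) (fun _ => x) (fun _ => hx)
    simpa using this
  intro x hx y hy
  have h2 := hS 2 (by omega) le_rfl ![x, y] (by intro i; fin_cases i <;> simpa)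
  rw [Matrix.det_fin_two] at h2
  simp only [Matrix.of_apply, Matrix.cons_val_zero, Matrix.cons_val_one, hT0 x hx, hT0 y hy,
    hTs y x] at h2
  have h3 : T x y = 0 := by
    have : T x y * T x y = 0 := by linarith
    exact mul_self_eq_zero.mp this
  simp only [hT] at h3
  linarith

lemma sr_antideriv {J : Set ℝ} (hJ : IsOpen J) (hJo : J.OrdConnected) {g : ℝ → ℝ}
    (hg : ContinuousOn g J) : ∃ G : ℝ → ℝ, ∀ z ∈ J, HasDerivAt G (g z) z := by
  rcases J.eq_empty_or_nonempty with rfl | ⟨z0, hz0⟩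
  · exact ⟨0, by simp⟩
  refine ⟨fun z => ∫ t in z0..z, g t, fun z hz => ?_⟩
  refine intervalIntegral.integral_hasDerivAt_right ?_ ?_ (hg.continuousAt (hJ.mem_nhds hz))
  · exact (hg.mono (hJo.uIcc_subset hz0 hz)).intervalIntegrable
  · exact hg.stronglyMeasurableAtFilter hJ z hz

open Filter Topology in
lemma sr_smooth {J X : Set ℝ} (hJ : IsOpen J) (hJo : J.OrdConnected) (hX : IsOpen X)
    (hXc : IsPreconnected X) (hXp : ∀ x ∈ X, 0 < x) (hXJ : ∀ x ∈ X, ∀ y ∈ X, x * y ∈ J)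
    (hJp : ∀ z ∈ J, 0 < z) (hJX : ∀ z ∈ J, Real.sqrt z ∈ X) {g : ℝ → ℝ} (hg : ContinuousOn g J)
    {r : ℕ} {u : Fin r → ℝ} (hu : ∀ i, u i ∈ X)
    (hD : (Matrix.of fun i j => g (u i * u j)).det ≠ 0)
    (hfe : ∀ x ∈ X, ∀ y ∈ X, g (x * y) = ∑ j, ∑ i, g (x * u i) *
        (Matrix.of fun i j => g (u i * u j))⁻¹ i j * g (u j * y)) (N : ℕ) :
    ContDiffOn ℝ N g J := by
  obtain ⟨G, hG⟩ := sr_antideriv hJ hJo hg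
  set D := (Matrix.of fun i j => g (u i * u j)) with hDdef
  -- averaged matrix
  set M : ℝ → Matrix (Fin r) (Fin r) ℝ := fun ε => Matrix.of fun j i =>
    (G (u j * (u i + ε)) - G (u j * u i)) / (u j * ε) with hM
  have hMlim : Tendsto M (𝓝[≠] 0) (𝓝 D) := by
    refine tendsto_pi_nhds.mpr fun j => tendsto_pi_nhds.mpr fun i => ?_
    have h1 : HasDerivAt (fun ε => G (u j * (u i + ε))) (g (u j * u i) * u j) 0 := by
      have h2 : HasDerivAt (fun ε => u j * (u i + ε)) (u j) 0 := by
        simpa using ((hasDerivAt_id (0:ℝ)).const_add (u i)).const_mul (u j)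
      have h3 : HasDerivAt G (g (u j * u i)) (u j * (u i + 0)) := by
        simpa using hG _ (hXJ _ (hu j) _ (hu i))
      exact h3.comp 0 h2
    have h4 := h1.tendsto_slope_zero
    have h5 := h4.div_const (u j)
    rw [mul_div_cancel_right₀ _ (hXp _ (hu j)).ne'] at h5
    refine h5.congr fun ε => ?_
    simp only [hM, Matrix.of_apply, zero_add, add_zero, smul_eq_mul]
    rw [div_mul_eq_div_div, div_right_comm, div_eq_inv_mul (_ - _) ε]
  have hdM : ∀ᶠ ε in 𝓝[≠] (0:ℝ), (M ε).det ≠ 0 := by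
    have := ((Continuous.matrix_det continuous_id).tendsto _).comp hMlim
    exact this.eventually_ne hD
  have hin : ∀ᶠ ε in 𝓝[≠] (0:ℝ), ∀ i, u i + ε ∈ X := by
    rw [eventually_all]
    intro i
    have : ContinuousAt (fun ε => u i + ε) 0 := by fun_prop
    exact (this.tendsto.mono_left nhdsWithin_le_nhds).eventually
      (hX.mem_nhds (by simpa using hu i))
  obtain ⟨ε, ⟨hdε, hinε⟩, hε⟩ := ((hdM.and hin).and self_mem_nhdsWithin).exists
  have hε : ε ≠ 0 := hε
  -- integrated functional equation
  have hIntEq : ∀ x ∈ X, ∀ y ∈ X, ∀ y' ∈ X, (G (x * y') - G (x * y)) / x =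
      ∑ j, ∑ i, g (x * u i) * D⁻¹ i j * ((G (u j * y') - G (u j * y)) / u j) := by
    intro x hx y hy y' hy'
    have hder : ∀ z ∈ X, HasDerivAt (fun z => G (x * z) / x -
        ∑ j, ∑ i, g (x * u i) * D⁻¹ i j * (G (u j * z) / u j)) 0 z := by
      intro z hz
      have hb : ∀ b ∈ X, HasDerivAt (fun z => G (b * z) / b) (g (b * z)) z := by
        intro b hb
        have h2 : HasDerivAt (fun z => b * z) b z := by
          simpa using (hasDerivAt_id z).const_mul b
        have h3 := ((hG _ (hXJ b hb z hz)).comp z h2).div_const b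
        rw [mul_div_cancel_right₀ _ (hXp _ hb).ne'] at h3
        exact h3
      have h4 := (hb x hx).sub (HasDerivAt.fun_sum (u := Finset.univ) fun j _ =>
        HasDerivAt.fun_sum (u := Finset.univ) fun i _ =>
          (hb (u j) (hu j)).const_mul (g (x * u i) * D⁻¹ i j))
      rw [← hfe x hx z hz, sub_self] at h4
      exact h4
    have hconst := hX.is_const_of_deriv_eq_zero hXc
      (fun z hz => (hder z hz).differentiableAt.differentiableWithinAt)
      (fun z hz => (hder z hz).deriv) hy' hy
    have hexp : ∑ j, ∑ i, g (x * u i) * D⁻¹ i j * ((G (u j * y') - G (u j * y)) / u j) =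
       ∑ j, ∑ i, g (x * u i) * D⁻¹ i j * (G (u j * y') / u j) -
       ∑ j, ∑ i, g (x * u i) * D⁻¹ i j * (G (u j * y) / u j) := by
      rw [← Finset.sum_sub_distrib]
      refine Finset.sum_congr rfl fun j _ => ?_
      rw [← Finset.sum_sub_distrib]
      refine Finset.sum_congr rfl fun i _ => ?_
      ring
    rw [hexp, sub_div]
    linarith
  set K : Fin r → ℝ → ℝ := fun i x => (G (x * (u i + ε)) - G (x * u i)) / x / ε with hK
  set A := (M ε)⁻¹ * D with hA
  have hv : ∀ x ∈ X, ∀ l, g (x * u l) = ∑ i, K i x * A i l := by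
    intro x hx l
    have hKv : (fun i => K i x) = (fun i => g (x * u i)) ᵥ* (D⁻¹ * M ε) := by
      rw [← Matrix.vecMul_vecMul]
      ext i
      simp only [hK, Matrix.vecMul, dotProduct]
      rw [hIntEq x hx _ (hu i) _ (hinε i), Finset.sum_div]
      refine Finset.sum_congr rfl fun j _ => ?_
      rw [Finset.sum_mul, Finset.sum_div]
      refine Finset.sum_congr rfl fun i _ => ?_
      simp only [hM, Matrix.of_apply]
      rw [← div_div]
      ring
    have h2 : (fun i => K i x) ᵥ* A = (fun i => g (x * u i)) := by
      rw [hKv, Matrix.vecMul_vecMul, hA, Matrix.mul_assoc, ← Matrix.mul_assoc (M ε),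
        Matrix.mul_nonsing_inv _ (isUnit_iff_ne_zero.mpr hdε), Matrix.one_mul,
        Matrix.nonsing_inv_mul _ (isUnit_iff_ne_zero.mpr hD), Matrix.vecMul_one]
    exact (congrFun h2 l).symm
  induction N with
  | zero => exact contDiffOn_zero.mpr hg
  | succ N ih =>
    have hGs : ContDiffOn ℝ ((N:ℕ)+1) G J := by
      rw [contDiffOn_succ_iff_deriv_of_isOpen hJ]
      refine ⟨fun z hz => (hG z hz).differentiableAt.differentiableWithinAt, by simp, ?_⟩
      exact ih.congr fun z hz => (hG z hz).deriv
    have hGb : ∀ b ∈ X, ContDiffOn ℝ ((N:ℕ)+1) (fun x => G (x * b)) X := fun b hb =>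
      hGs.comp (contDiff_id.mul contDiff_const).contDiffOn (fun x hx => hXJ x hx b hb)
    have hKs : ∀ i, ContDiffOn ℝ ((N:ℕ)+1) (K i) X := by
      intro i
      exact (((hGb _ (hinε i)).sub (hGb _ (hu i))).div contDiffOn_id
        (fun x hx => (hXp x hx).ne')).div_const ε
    have hvs : ∀ l, ContDiffOn ℝ ((N:ℕ)+1) (fun x => g (x * u l)) X := by
      intro l
      refine ContDiffOn.congr ?_ (fun x hx => hv x hx l)
      exact ContDiffOn.sum fun i _ => (hKs i).mul contDiffOn_const
    have hsq : ContDiffOn ℝ ((N:ℕ)+1) Real.sqrt J := fun z hz =>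
      (Real.contDiffAt_sqrt (hJp z hz).ne').contDiffWithinAt
    have hvsq : ∀ l, ContDiffOn ℝ ((N:ℕ)+1) (fun z => g (Real.sqrt z * u l)) J := fun l =>
      (hvs l).comp hsq hJX
    push_cast
    refine ContDiffOn.congr (f := fun z => ∑ j, ∑ i, g (Real.sqrt z * u i) * D⁻¹ i j *
      g (Real.sqrt z * u j)) ?_ ?_
    · exact ContDiffOn.sum fun j _ => ContDiffOn.sum fun i _ =>
        ((hvsq i).mul contDiffOn_const).mul (hvsq j)
    · intro z hz
      have := hfe _ (hJX z hz) _ (hJX z hz)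
      rw [Real.mul_self_sqrt (hJp z hz).le] at this
      rw [this]
      refine Finset.sum_congr rfl fun j _ => Finset.sum_congr rfl fun i _ => ?_
      rw [mul_comm (u j)]

lemma sr_mul_mem {J : Set ℝ} (hJo : J.OrdConnected) {x y : ℝ} (hx : 0 < x) (hy : 0 < y)
    (hx2 : x^2 ∈ J) (hy2 : y^2 ∈ J) : x * y ∈ J := by
  rcases le_total x y with h | h
  · exact hJo.out hx2 hy2 ⟨by nlinarith, by nlinarith⟩
  · exact hJo.out hy2 hx2 ⟨by nlinarith, by nlinarith⟩

open Filter Topology in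
/-- The nonsmooth case on `[0,R)`. -/
lemma sr_nonsmooth {R : EReal} (hR : 0 < R) {k n : ℕ} (hk : 1 ≤ k) (hkn : k + 3 ≤ n) {g : ℝ → ℝ}
    {I J : Set ℝ} (hI : I = {x : ℝ | 0 ≤ x ∧ (x : EReal) < R})
    (hJd : J = {x : ℝ | 0 < x ∧ (x : EReal) < R})
    (hJ : IsOpen J) (hJo : J.OrdConnected)
    (H : ∀ a ∈ I, ∀ u : Fin n → ℝ, (∀ i j, a + u i * u j ∈ I) →
          (Matrix.of fun i j => g (a + u i * u j)).PosSemidef ∧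
          (Matrix.of fun i j => g (a + u i * u j)).rank ≤ k) :
    ContDiffOn ℝ k g J ∧ (∀ x ∈ J, g 0 ≤ g x) ∧
      ∀ x, 0 < x → 2 * x ∈ J → 2 * g x ≤ g (2 * x) + g 0 := by
  have h0I : (0:ℝ) ∈ I := by rw [hI]; exact ⟨le_rfl, by simpa using hR⟩
  have hJI : J ⊆ I := by rw [hI, hJd]; exact fun x hx => ⟨hx.1.le, hx.2⟩
  have hJp : ∀ x ∈ J, 0 < x := by rw [hJd]; exact fun x hx => hx.1
  have hdown : ∀ x ∈ I, ∀ y, 0 ≤ y → y ≤ x → y ∈ I := by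
    rw [hI]; exact fun x hx y h0 hy => ⟨h0, (EReal.coe_le_coe_iff.mpr hy).trans_lt hx.2⟩
  have hdownJ : ∀ x ∈ J, ∀ y, 0 < y → y ≤ x → y ∈ J := by
    rw [hJd]; exact fun x hx y h0 hy => ⟨h0, (EReal.coe_le_coe_iff.mpr hy).trans_lt hx.2⟩
  have hmonoI : MonotoneOn g I := by
    intro x hx y hy hxy
    have hs := Real.mul_self_sqrt (sub_nonneg.mpr hxy)
    have h := sr_psd (fun u hu => (H x hx u hu).1) (ι := Fin 2) (by simp; omega)
      ![0, Real.sqrt (y - x)] (by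
        intro i j
        fin_cases i <;> fin_cases j <;> simp [hs, hx, hy])
    have h2 := h.dotProduct_mulVec_nonneg ![1, -1]
    simp [Matrix.mulVec, dotProduct, Fin.sum_univ_two, hs] at h2
    linarith
  have hpos : ∀ x ∈ J, 0 ≤ g x := by
    intro x hx
    have h := sr_psd (fun u hu => (H x (hJI hx) u hu).1) (ι := Fin 1) (by simp; omega)
      (fun _ => 0) (by intro i j; simpa using hJI hx)
    have h2 := h.dotProduct_mulVec_nonneg (fun _ => 1)
    simpa [Matrix.mulVec, dotProduct] using h2
  have hmul : ∀ x y, 0 < x → 0 < y → x^2 ∈ J → y^2 ∈ J →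
      g (x*y)^2 ≤ g (x^2) * g (y^2) := by
    intro x y hx hy hx2 hy2
    have hxy := hJI (sr_mul_mem hJo hx hy hx2 hy2)
    have h := sr_psd (fun u hu => (H 0 h0I u hu).1) (ι := Fin 2) (by simp; omega)
      ![x, y] (by
        intro i j
        have h1 := hJI hx2
        have h2 := hJI hy2
        rw [sq] at h1 h2
        fin_cases i <;> fin_cases j <;> simp [h1, h2, hxy, mul_comm y x])
    have h2 := h.det_nonneg
    rw [Matrix.det_fin_two] at h2
    simp [mul_comm y x] at h2
    rw [sq x, sq y]
    nlinarith
  have hcont := sr_cont hJ hJo hJp hpos (hmonoI.mono hJI) hmul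
  refine ⟨?_, fun x hx => hmonoI h0I (hJI hx) (hJp x hx).le, ?_⟩
  · set X : Set ℝ := {x | 0 < x ∧ x^2 ∈ J} with hX
    have hXJ : ∀ x ∈ X, ∀ y ∈ X, x * y ∈ J := fun x hx y hy => sr_mul_mem hJo hx.1 hy.1 hx.2 hy.2
    have hXo : IsOpen X := isOpen_Ioi.inter (hJ.preimage (by fun_prop : Continuous fun x : ℝ => x^2))
    have hXc : IsPreconnected X := by
      refine Set.OrdConnected.isPreconnected ⟨fun x hx y hy z hz => ?_⟩
      have hz0 : 0 < z := hx.1.trans_le hz.1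
      exact ⟨hz0, hdownJ _ hy.2 _ (by positivity) (by gcongr; exact hz.2)⟩
    obtain ⟨r, u, hu, hD, hfe⟩ := sr_fe (X := X) (g := g) (k := k) (by
      intro r h1 h2 ι _ _ hc u hu
      have := sr_det_zero (fun u hu => (H 0 h0I u hu).2) (ι := ι) (by omega) (by omega) u
        (fun i j => by rw [zero_add]; exact hJI (hXJ _ (hu i) _ (hu j)))
      simpa using this)
    exact sr_smooth hJ hJo hXo hXc (fun x hx => hx.1) hXJ hJp
      (fun z hz => ⟨Real.sqrt_pos.mpr (hJp z hz), by rwa [Real.sq_sqrt (hJp z hz).le]⟩)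
      hcont hu hD hfe k
  · intro x hx hx2
    have hxI : x ∈ I := hdown _ (hJI hx2) x hx.le (by linarith)
    have hs := Real.mul_self_sqrt hx.le
    have h2x : x + x ∈ I := by rw [← two_mul]; exact hJI hx2
    have h := sr_psd (fun u hu => (H x hxI u hu).1) (ι := Fin 3) (by simp; omega)
      ![Real.sqrt x, -Real.sqrt x, 0] (by
        intro i j
        fin_cases i <;> fin_cases j <;> simp [hs, hxI, h2x, h0I])
    have h2 := h.dotProduct_mulVec_nonneg ![1, 1, -2]
    simp [Matrix.mulVec, dotProduct, Fin.sum_univ_three, hs] at h2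
    rw [two_mul x]
    linarith

lemma sr_open (R : EReal) : IsOpen {x : ℝ | 0 < x ∧ (x : EReal) < R} :=
  isOpen_Ioi.inter (isOpen_Iio.preimage continuous_coe_real_ereal)

lemma sr_ord (R : EReal) : ({x : ℝ | 0 < x ∧ (x : EReal) < R}).OrdConnected :=
  ⟨fun _ hx _ hy _ hz => ⟨hx.1.trans_le hz.1, (EReal.coe_le_coe_iff.mpr hz.2).trans_lt hy.2⟩⟩

lemma sr_coeff' {R : EReal} (hR : 0 < R) {k n : ℕ} (hkn : k < n) {p : Polynomial ℝ}
    (hp : p.natDegree ≤ k - 1) {I : Set ℝ} (hI : I = {x : ℝ | 0 ≤ x ∧ (x : EReal) < R}) {f : ℝ → ℝ}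
    (hfp : ∀ x ∈ I, f x = p.eval x)
    (H : ∀ a ∈ I, ∀ u : Fin n → ℝ, (∀ i j, a + u i * u j ∈ I) →
          (Matrix.of fun i j => f (a + u i * u j)).PosSemidef ∧
          (Matrix.of fun i j => f (a + u i * u j)).rank ≤ k) (m : ℕ) : 0 ≤ p.coeff m := by
  obtain ⟨b, hb0, hbR⟩ := EReal.lt_iff_exists_real_btwn.mp hR
  have hb0 : 0 < b := by exact_mod_cast hb0
  have h0I : (0:ℝ) ∈ I := by rw [hI]; exact ⟨le_rfl, by simpa using hR⟩
  set u : Fin n → ℝ := fun i => Real.sqrt b * (((i:ℕ):ℝ) / n) with hu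
  have hn : (0:ℝ) < n := by exact_mod_cast (by omega : 0 < n)
  have hsb : 0 < Real.sqrt b := Real.sqrt_pos.mpr hb0
  have hmem : ∀ i j, 0 + u i * u j ∈ I := by
    intro i j
    have h01 : ∀ i : Fin n, 0 ≤ ((i:ℕ):ℝ) / n ∧ ((i:ℕ):ℝ) / n ≤ 1 := by
      intro i
      refine ⟨by positivity, ?_⟩
      rw [div_le_one hn]
      exact_mod_cast i.2.le
    rw [hI, zero_add]
    have h1 : u i * u j = b * (((i:ℕ):ℝ) / n * (((j:ℕ):ℝ) / n)) := by
      simp only [hu]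
      linear_combination ((((i:ℕ):ℝ) / n) * (((j:ℕ):ℝ) / n)) * Real.mul_self_sqrt hb0.le
    have h2 : (((i:ℕ):ℝ) / n * (((j:ℕ):ℝ) / n)) ≤ 1 := mul_le_one₀ (h01 i).2 (h01 j).1 (h01 j).2
    have h3 : 0 ≤ (((i:ℕ):ℝ) / n * (((j:ℕ):ℝ) / n)) := mul_nonneg (h01 i).1 (h01 j).1
    refine ⟨by rw [h1]; positivity, lt_of_le_of_lt (EReal.coe_le_coe_iff.mpr ?_) hbR⟩
    rw [h1]
    nlinarith
  refine sr_coeff hkn hp hfp (u := u) ?_ hmem (H 0 h0I u hmem).1 m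
  intro i j hij
  simp only [hu] at hij
  have h1 := mul_left_cancel₀ hsb.ne' hij
  rw [div_left_inj' hn.ne'] at h1
  ext
  exact_mod_cast h1

/-- Polynomiality on an open subinterval from the rank bound. -/
lemma sr_poly {I J : Set ℝ} (hJI : J ⊆ I) (hJ : IsOpen J) (hJo : J.OrdConnected) {k n : ℕ}
    (hk : 1 ≤ k) (hkn : k < n) {f : ℝ → ℝ} (hf : ContDiffOn ℝ k f J)
    (H : ∀ a ∈ I, ∀ u : Fin n → ℝ, (∀ i j, a + u i * u j ∈ I) →
          (Matrix.of fun i j => f (a + u i * u j)).rank ≤ k) :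
    ∃ p : Polynomial ℝ, p.natDegree ≤ k - 1 ∧ ∀ x ∈ J, f x = p.eval x :=
  sr_main hJ hJo.isPreconnected hk hf fun a ha u hu =>
    sr_det_zero (H a (hJI ha)) (by simp) (by simpa using hkn) u fun i j => hJI (hu i j)

open Filter Topology in
lemma sr_zero_mem {R : EReal} (hR : 0 < R) :
    ∀ᶠ x in 𝓝[>] (0:ℝ), x ∈ {x : ℝ | 0 < x ∧ (x : EReal) < R} := by
  obtain ⟨b, hb0, hbR⟩ := EReal.lt_iff_exists_real_btwn.mp hR
  have hb0 : 0 < b := by exact_mod_cast hb0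
  filter_upwards [Ioo_mem_nhdsGT hb0] with x hx
  exact ⟨hx.1, (EReal.coe_lt_coe_iff.mpr hx.2).trans hbR⟩

open Filter Topology in
lemma sr_part1 {R : EReal} (hR : 0 < R) {I : Set ℝ}
    (hI : I = {x : ℝ | 0 ≤ x ∧ (x : EReal) < R} ∨
          I = {x : ℝ | -R < (x : EReal) ∧ (x : EReal) < R})
    {k n : ℕ} (hk : 1 ≤ k) (hkn : k < n) {f : ℝ → ℝ} (hf : ContDiffOn ℝ k f I)
    (H : ∀ a ∈ I, ∀ u : Fin n → ℝ, (∀ i j, a + u i * u j ∈ I) →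
        (Matrix.of fun i j => f (a + u i * u j)).rank ≤ k) :
      ∃ p : Polynomial ℝ, p.natDegree ≤ k - 1 ∧ ∀ x ∈ I, f x = p.eval x := by
  rcases hI with hI | hI
  · have hJI : {x : ℝ | 0 < x ∧ (x : EReal) < R} ⊆ I := by
      rw [hI]; exact fun x hx => ⟨hx.1.le, hx.2⟩
    obtain ⟨p, hp, hpe⟩ := sr_poly hJI (sr_open R) (sr_ord R) hk hkn (hf.mono hJI) H
    refine ⟨p, hp, fun x hx => ?_⟩
    rcases (show 0 ≤ x by rw [hI] at hx; exact hx.1).eq_or_lt with h | h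
    · subst h
      have h1 : Tendsto f (𝓝[>] 0) (𝓝 (f 0)) := by
        refine (hf.continuousOn 0 hx).tendsto.mono_left ?_
        refine le_inf nhdsWithin_le_nhds (le_principal_iff.mpr ?_)
        filter_upwards [sr_zero_mem hR] with x hx using hJI hx
      have h2 : Tendsto (fun x => p.eval x) (𝓝[>] (0:ℝ)) (𝓝 (p.eval 0)) :=
        (p.continuous.tendsto 0).mono_left nhdsWithin_le_nhds
      refine tendsto_nhds_unique (h1.congr' ?_) h2
      filter_upwards [sr_zero_mem hR] with x hx using hpe x hx
    · exact hpe x ⟨h, by rw [hI] at hx; exact hx.2⟩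
  · refine sr_poly subset_rfl ?_ ?_ hk hkn hf H
    · rw [hI]
      exact (isOpen_Ioi.preimage continuous_coe_real_ereal).inter
        (isOpen_Iio.preimage continuous_coe_real_ereal)
    · rw [hI]
      exact ⟨fun _ hx _ hy _ hz => ⟨hx.1.trans_le (EReal.coe_le_coe_iff.mpr hz.1),
        (EReal.coe_le_coe_iff.mpr hz.2).trans_lt hy.2⟩⟩

lemma sr_matrix_eq {I : Set ℝ} {n : ℕ} {f : ℝ → ℝ} {p : Polynomial ℝ} (h : ∀ x ∈ I, f x = p.eval x)
    {a : ℝ} {u : Fin n → ℝ} (hu : ∀ i j, a + u i * u j ∈ I) :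
    (Matrix.of fun i j => f (a + u i * u j)) = Matrix.of fun i j => p.eval (a + u i * u j) := by
  ext i j
  exact h _ (hu i j)

/-- **Special rank two, fixed dimension.** Let `I = [0,R)` or `(-R,R)` with `0 < R ≤ ∞`,
`1 ≤ k < n`, and `f ∈ C^k(I)`.  (1) `f[a·1 + uuᵀ]` is symmetric of rank at most `k` for
all `a ∈ I` and `u ∈ ℝⁿ` with `a + uᵢuⱼ ∈ I` iff `f` agrees on `I` with a polynomial of
degree at most `k-1`.  (2) When `I = [0,R)`, `f[a·1 + uuᵀ] ∈ P_n^k` for all such `a, u`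
iff `f` agrees on `I` with a polynomial of degree at most `k-1` with nonnegative
coefficients; and if `k ≤ n-3`, this equivalence holds for arbitrary `f` without the
differentiability assumption. -/
theorem special_rank_two_fixed_dimension
    (R : EReal) (hR : 0 < R) (I : Set ℝ)
    (hI : I = {x : ℝ | 0 ≤ x ∧ (x : EReal) < R} ∨
          I = {x : ℝ | -R < (x : EReal) ∧ (x : EReal) < R})
    (k n : ℕ) (hk : 1 ≤ k) (hkn : k < n) (f : ℝ → ℝ) (hf : ContDiffOn ℝ k f I) :
    ((∀ a ∈ I, ∀ u : Fin n → ℝ, (∀ i j, a + u i * u j ∈ I) →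
        (Matrix.of fun i j => f (a + u i * u j)).IsSymm ∧
        (Matrix.of fun i j => f (a + u i * u j)).rank ≤ k) ↔
      ∃ p : Polynomial ℝ, p.natDegree ≤ k - 1 ∧ ∀ x ∈ I, f x = p.eval x) ∧
    (I = {x : ℝ | 0 ≤ x ∧ (x : EReal) < R} →
      ((∀ a ∈ I, ∀ u : Fin n → ℝ, (∀ i j, a + u i * u j ∈ I) →
          (Matrix.of fun i j => f (a + u i * u j)).PosSemidef ∧
          (Matrix.of fun i j => f (a + u i * u j)).rank ≤ k) ↔
        ∃ p : Polynomial ℝ, p.natDegree ≤ k - 1 ∧ (∀ m : ℕ, 0 ≤ p.coeff m) ∧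
          ∀ x ∈ I, f x = p.eval x)) ∧
    (I = {x : ℝ | 0 ≤ x ∧ (x : EReal) < R} → k ≤ n - 3 →
      ∀ g : ℝ → ℝ,
        ((∀ a ∈ I, ∀ u : Fin n → ℝ, (∀ i j, a + u i * u j ∈ I) →
            (Matrix.of fun i j => g (a + u i * u j)).PosSemidef ∧
            (Matrix.of fun i j => g (a + u i * u j)).rank ≤ k) ↔
          ∃ p : Polynomial ℝ, p.natDegree ≤ k - 1 ∧ (∀ m : ℕ, 0 ≤ p.coeff m) ∧
            ∀ x ∈ I, g x = p.eval x)) := by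
  refine ⟨⟨fun H => sr_part1 hR hI hk hkn hf fun a ha u hu => (H a ha u hu).2, ?_⟩, ?_, ?_⟩
  · rintro ⟨p, hp, hpe⟩ a ha u hu
    refine ⟨?_, ?_⟩
    · ext i j
      simp [mul_comm]
    · rw [sr_matrix_eq hpe hu]
      exact sr_rank hk hp a u
  · intro hI0
    constructor
    · intro H
      obtain ⟨p, hp, hpe⟩ := sr_part1 hR hI hk hkn hf fun a ha u hu => (H a ha u hu).2
      exact ⟨p, hp, sr_coeff' hR hkn hp hI0 hpe H, hpe⟩
    · rintro ⟨p, hp, hpc, hpe⟩ a ha u hu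
      rw [sr_matrix_eq hpe hu]
      have ha0 : 0 ≤ a := by rw [hI0] at ha; exact ha.1
      exact ⟨sr_pos hk hp hpc ha0 u, sr_rank hk hp a u⟩
  · intro hI0 hk3 g
    constructor
    · intro H
      obtain ⟨hg, hg1, hg2⟩ := sr_nonsmooth hR hk (by omega) hI0 rfl (sr_open R) (sr_ord R) H
      have hJI : {x : ℝ | 0 < x ∧ (x : EReal) < R} ⊆ I := by
        rw [hI0]; exact fun x hx => ⟨hx.1.le, hx.2⟩
      obtain ⟨p, hp, hpe⟩ := sr_poly hJI (sr_open R) (sr_ord R) hk hkn hg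
        (fun a ha u hu => (H a ha u hu).2)
      have hpt : Filter.Tendsto (fun x => p.eval x) (nhdsWithin (0:ℝ) (Ioi 0))
          (nhds (p.eval 0)) := (p.continuous.tendsto 0).mono_left nhdsWithin_le_nhds
      have hpt2 : Filter.Tendsto (fun x => p.eval (2 * x) + g 0) (nhdsWithin (0:ℝ) (Ioi 0))
          (nhds (p.eval 0 + g 0)) := by
        have hc : Continuous fun x : ℝ => p.eval (2 * x) + g 0 := by
          have := p.continuous
          fun_prop
        simpa using (hc.tendsto 0).mono_left (nhdsWithin_le_nhds (s := Ioi 0))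
      have hle : g 0 ≤ p.eval 0 := by
        refine ge_of_tendsto hpt ?_
        filter_upwards [sr_zero_mem hR] with x hx
        rw [← hpe x hx]
        exact hg1 x hx
      have hge : 2 * p.eval 0 ≤ p.eval 0 + g 0 := by
        refine le_of_tendsto_of_tendsto (hpt.const_mul 2) hpt2 ?_
        have h2 : ∀ᶠ x in nhdsWithin (0:ℝ) (Ioi 0), 2 * x ∈ {x : ℝ | 0 < x ∧ (x : EReal) < R} := by
          have ht : Filter.Tendsto (fun x : ℝ => 2 * x) (nhdsWithin (0:ℝ) (Ioi 0))
              (nhdsWithin (0:ℝ) (Ioi 0)) := by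
            refine tendsto_nhdsWithin_of_tendsto_nhds_of_eventually_within _ ?_ ?_
            · have hc : Continuous fun x : ℝ => 2 * x := by fun_prop
              simpa using (hc.tendsto 0).mono_left (nhdsWithin_le_nhds (s := Ioi 0))
            · filter_upwards [self_mem_nhdsWithin] with x hx
              have hx : 0 < x := hx
              show 0 < 2 * x
              positivity
          exact ht.eventually (sr_zero_mem hR)
        filter_upwards [sr_zero_mem hR, h2] with x hx hx2
        have := hg2 x hx.1 hx2
        rwa [hpe x hx, hpe _ hx2] at this
      have hpe' : ∀ x ∈ I, g x = p.eval x := by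
        intro x hx
        rw [hI0] at hx
        rcases hx.1.eq_or_lt with h | h
        · subst h; linarith
        · exact hpe x ⟨h, hx.2⟩
      exact ⟨p, hp, sr_coeff' hR hkn hp hI0 hpe' H, hpe'⟩
    · rintro ⟨p, hp, hpc, hpe⟩ a ha u hu
      rw [sr_matrix_eq hpe hu]
      have ha0 : 0 ≤ a := by rw [hI0] at ha; exact ha.1
      exact ⟨sr_pos hk hp hpc ha0 u, sr_rank hk hp a u⟩
end

section
/- Let a ∈ ℝ, integers n ≥ 2 and 1 ≤ k ≤ n, 0 < R ≤ ∞, I = (a−R, a+R), and f : I → ℝ. Suppose f admits at least k nonzero derivatives at a, i.e., there exist integers 0 ≤ m_1 < ⋯ < m_k such that f is m_k times differentiable at a and f^{(m_i)}(a) ≠ 0 for i = 1,…,k. Then there exists u ∈ ℝ^n such that a + u_i u_j ∈ I for all i, j and the matrix f[a·1_{n×n} + u uᵀ] has rank at least k. -/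
open Matrix Set

open Filter Topology Asymptotics in
theorem core_det {k : ℕ} (g : ℝ → ℝ) (m : Fin k → ℕ) (hm : Function.Injective m) (c : Fin k → ℝ)
    (hc : ∀ p, c p ≠ 0) (N : ℕ) (hN : ∀ p, m p ≤ N)
    (hg : (fun x => g x - ∑ p, c p * x ^ m p) =o[𝓝 0] fun x => x ^ N) :
    ∀ᶠ t : ℝ in 𝓝[>] 0,
      (Matrix.of fun i j : Fin k => g ((t * 2 ^ (i : ℕ)) * (t * 2 ^ (j : ℕ)))).det ≠ 0 := by
  set V : Matrix (Fin k) (Fin k) ℝ := (Matrix.vandermonde fun p => (2 : ℝ) ^ m p)ᵀ with hV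
  have hVdet : V.det ≠ 0 := by
    rw [hV, Matrix.det_transpose, Matrix.det_vandermonde_ne_zero_iff]
    intro p q h
    exact hm (pow_right_injective₀ (by norm_num : (0:ℝ) < 2) (by norm_num) h)
  have hVu : IsUnit V.det := isUnit_iff_ne_zero.mpr hVdet
  have hVe : ∀ i p, V i p = ((2 : ℝ) ^ (i : ℕ)) ^ m p := by
    intro i p
    simp [hV, Matrix.vandermonde_apply, ← pow_mul, mul_comm]
  let T : ℝ → Matrix (Fin k) (Fin k) ℝ := fun t => diagonal fun p => t ^ m p
  let S : ℝ → Matrix (Fin k) (Fin k) ℝ := fun t => diagonal fun p => t ^ (N - m p)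
  let r : ℝ → ℝ := fun x => g x - ∑ p, c p * x ^ m p
  let G : ℝ → Matrix (Fin k) (Fin k) ℝ := fun t => Matrix.of fun i j =>
    r ((t * 2 ^ (i : ℕ)) * (t * 2 ^ (j : ℕ))) / t ^ (2 * N)
  let F : ℝ → Matrix (Fin k) (Fin k) ℝ := fun t =>
    diagonal c + S t * V⁻¹ * G t * V⁻¹ᵀ * S t
  have hS : Continuous S := by
    apply Continuous.matrix_diagonal
    fun_prop
  have hG : Tendsto G (𝓝[>] 0) (𝓝 0) := by
    refine tendsto_pi_nhds.mpr fun i => ?_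
    refine tendsto_pi_nhds.mpr fun j => ?_
    have hx : Tendsto (fun t : ℝ => (t * 2 ^ (i : ℕ)) * (t * 2 ^ (j : ℕ))) (𝓝[>] 0) (𝓝 0) := by
      have : Continuous (fun t : ℝ => (t * 2 ^ (i : ℕ)) * (t * 2 ^ (j : ℕ))) := by fun_prop
      have h := this.tendsto 0
      simp only [zero_mul] at h
      exact h.mono_left nhdsWithin_le_nhds
    have h1 := hg.comp_tendsto hx
    have h2 : ((fun x : ℝ => x ^ N) ∘ fun t : ℝ => (t * 2 ^ (i : ℕ)) * (t * 2 ^ (j : ℕ)))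
        =O[𝓝[>] 0] fun t : ℝ => t ^ (2 * N) := by
      have : ((fun x : ℝ => x ^ N) ∘ fun t : ℝ => (t * 2 ^ (i : ℕ)) * (t * 2 ^ (j : ℕ)))
        = fun t : ℝ => ((2 ^ (i : ℕ)) * (2 ^ (j : ℕ))) ^ N * t ^ (2 * N) := by
        funext t
        simp only [Function.comp]
        rw [pow_mul]
        rw [← mul_pow]
        congr 1
        ring
      rw [this]
      exact isBigO_const_mul_self _ _ _
    exact (h1.trans_isBigO h2).tendsto_div_nhds_zero
  have hF : Tendsto F (𝓝[>] 0) (𝓝 (diagonal c)) := by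
    have hS' : Tendsto S (𝓝[>] 0) (𝓝 (S 0)) := (hS.tendsto 0).mono_left nhdsWithin_le_nhds
    have h := (tendsto_const_nhds (x := diagonal c)).add ((((hS'.mul
      (tendsto_const_nhds (x := V⁻¹))).mul hG).mul (tendsto_const_nhds (x := V⁻¹ᵀ))).mul hS')
    simpa using h
  have hdet : Tendsto (fun t => (F t).det) (𝓝[>] 0) (𝓝 (diagonal c).det) :=
    ((continuous_id.matrix_det).tendsto (diagonal c)).comp hF
  have hd0 : (diagonal c).det ≠ 0 := by
    rw [det_diagonal]; exact Finset.prod_ne_zero_iff.mpr fun p _ => hc p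
  filter_upwards [hdet.eventually_ne hd0, self_mem_nhdsWithin] with t ht htpos
  have htpos : 0 < t := htpos
  have hTS : T t * S t = t ^ N • (1 : Matrix (Fin k) (Fin k) ℝ) := by
    simp only [T, S, diagonal_mul_diagonal, ← pow_add]
    rw [smul_one_eq_diagonal]
    congr 1
    funext p
    rw [Nat.add_sub_cancel' (hN p)]
  have hST : S t * T t = t ^ N • (1 : Matrix (Fin k) (Fin k) ℝ) := by
    rw [← hTS]; simp only [T, S, diagonal_mul_diagonal, mul_comm]
  have key : (Matrix.of fun i j : Fin k => g ((t * 2 ^ (i : ℕ)) * (t * 2 ^ (j : ℕ))))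
      = V * T t * F t * T t * Vᵀ := by
    have e1 : V * T t * F t * T t * Vᵀ = V * T t * diagonal c * T t * Vᵀ
        + V * (T t * S t) * V⁻¹ * G t * V⁻¹ᵀ * (S t * T t) * Vᵀ := by
      simp only [F, mul_add, add_mul, Matrix.mul_assoc]
    have e2 : V * (T t * S t) * V⁻¹ * G t * V⁻¹ᵀ * (S t * T t) * Vᵀ = t ^ (2 * N) • G t := by
      have h3 : V⁻¹ᵀ * Vᵀ = 1 := by
        rw [← transpose_mul, mul_nonsing_inv _ hVu, transpose_one]
      rw [hTS, hST]
      simp only [Matrix.mul_smul, Matrix.smul_mul, Matrix.mul_one, mul_nonsing_inv _ hVu,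
        Matrix.one_mul, Matrix.mul_assoc, h3, smul_smul]
      rw [two_mul, pow_add]
    rw [e1, e2]
    ext i j
    have e3 : (V * T t * diagonal c * T t * Vᵀ) i j
        = ∑ p, c p * ((t * 2 ^ (i : ℕ)) * (t * 2 ^ (j : ℕ))) ^ m p := by
      rw [Matrix.mul_apply]
      refine Finset.sum_congr rfl fun p _ => ?_
      simp only [T, mul_diagonal, transpose_apply, hVe, mul_pow]
      ring
    rw [Matrix.add_apply, e3, Matrix.smul_apply]
    simp only [G, r, Matrix.of_apply, smul_eq_mul]
    rw [mul_div_cancel₀ _ (pow_pos htpos _).ne']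
    ring
  rw [key]
  have hT : (T t).det ≠ 0 := by
    simp only [T, det_diagonal]
    exact Finset.prod_ne_zero_iff.mpr fun p _ => (pow_pos htpos _).ne'
  simp only [det_mul, det_transpose]
  exact mul_ne_zero (mul_ne_zero (mul_ne_zero (mul_ne_zero hVdet hT) ht) hT) hVdet

/-- The first `k` elements of a set of naturals. -/
theorem first_k (P : ℕ → Prop) {k : ℕ} (hk1 : 1 ≤ k) (m : Fin k → ℕ) (hm : StrictMono m)
    (hP : ∀ i, P (m i)) : ∃ m' : Fin k → ℕ, Function.Injective m' ∧ (∀ i, P (m' i)) ∧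
      ∃ N, (∀ i, m' i ≤ N) ∧ N ≤ m ⟨k - 1, by omega⟩ ∧
        ∀ j ≤ N, P j → ∃ i, m' i = j := by
  classical
  have hcount : k ≤ Nat.count P (m ⟨k - 1, by omega⟩ + 1) := by
    rw [Nat.count_eq_card_filter_range]
    calc k = (Finset.univ.image m).card := by
          rw [Finset.card_image_of_injective _ hm.injective]; simp
      _ ≤ _ := by
          apply Finset.card_le_card
          intro x hx
          obtain ⟨i, -, rfl⟩ := Finset.mem_image.mp hx
          simp only [Finset.mem_filter, Finset.mem_range]
          refine ⟨Nat.lt_succ_of_le (hm.monotone ?_), hP i⟩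
          rw [Fin.le_def]; simp; omega
  have hcard : ∀ i < k, ∀ hf : (Set.ofPred P).Finite, i < hf.toFinset.card := fun i hi hf =>
    (hi.trans_le hcount).trans_le (Nat.count_le_card hf _)
  refine ⟨fun i => Nat.nth P i, ?_, fun i => Nat.nth_mem _ (hcard i i.2), Nat.nth P (k - 1),
    ?_, ?_, ?_⟩
  · intro i j h
    have h : Nat.nth P i = Nat.nth P j := h
    have h2 := congrArg (Nat.count P) h
    rw [Nat.count_nth (hcard i i.2), Nat.count_nth (hcard j j.2)] at h2
    exact Fin.ext h2
  · intro i
    rcases Nat.lt_or_ge i (k - 1) with h | h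
    · exact (Nat.nth_lt_nth' h (hcard _ (by omega))).le
    · have : (i : ℕ) = k - 1 := by omega
      simp [this]
  · exact Nat.lt_add_one_iff.mp (Nat.nth_lt_of_lt_count (by omega))
  · intro j hj hPj
    have h1 := Nat.count_monotone P hj
    rw [Nat.count_nth (hcard _ (by omega))] at h1
    exact ⟨⟨Nat.count P j, by omega⟩, Nat.nth_count hPj⟩

open Filter Topology Asymptotics in
theorem taylor_within_at (f : ℝ → ℝ) (I : Set ℝ) (a : ℝ) (hI : I ∈ 𝓝 a) (N : ℕ)
    (hf : ContDiffWithinAt ℝ N f I a) :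
    (fun x => f (a + x) - ∑ j ∈ Finset.range (N + 1),
      ((j.factorial : ℝ)⁻¹ * iteratedDerivWithin j f I a) * x ^ j) =o[𝓝 0] fun x => x ^ N := by
  obtain ⟨u, huo, hau, hu⟩ := hf.contDiffOn' le_rfl (by simp)
  have hmem : insert a I ∩ u ∈ 𝓝 a :=
    inter_mem (mem_of_superset hI (subset_insert _ _)) (huo.mem_nhds hau)
  obtain ⟨ε, hε, hb⟩ := Metric.mem_nhds_iff.mp hmem
  have ht := taylor_isLittleO (convex_ball a ε) (Metric.mem_ball_self hε) (hu.mono hb)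
  rw [(Metric.isOpen_ball).nhdsWithin_eq (Metric.mem_ball_self hε)] at ht
  have hx : Tendsto (fun x : ℝ => a + x) (𝓝 0) (𝓝 a) := by
    have := (continuous_const_add a).tendsto 0
    simpa using this
  have h := ht.comp_tendsto hx
  refine h.congr (fun x => ?_) (fun x => by simp)
  simp only [Function.comp, taylor_within_apply, add_sub_cancel_left, smul_eq_mul]
  congr 1
  refine Finset.sum_congr rfl fun j _ => ?_
  have : iteratedDerivWithin j f (Metric.ball a ε) a = iteratedDerivWithin j f I a := by
    have he : Metric.ball a ε =ᶠ[𝓝 a] I := by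
      filter_upwards [Metric.ball_mem_nhds a hε, hI] with x h1 h2
      exact propext ⟨fun _ => h2, fun _ => h1⟩
    simp only [iteratedDerivWithin, iteratedFDerivWithin_congr_set he]
  rw [this]; ring

open Filter Topology in
/-- Let `a ∈ ℝ`, `n ≥ 2`, `1 ≤ k ≤ n`, `0 < R ≤ ∞`, `I = (a-R, a+R)`, and suppose
`f : I → ℝ` admits at least `k` nonzero derivatives at `a` (within `I`), of orders
`m 0 < ⋯ < m (k-1)`.  Then there exists `u ∈ ℝⁿ` with `a + uᵢuⱼ ∈ I` for all `i, j`
such that `f[a·1 + uuᵀ]` has rank at least `k`. -/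
theorem exists_special_rank_two_with_large_rank
    (a : ℝ) (n k : ℕ) (hn : 2 ≤ n) (hk1 : 1 ≤ k) (hkn : k ≤ n)
    (R : EReal) (hR : 0 < R) (I : Set ℝ)
    (hI : I = {x : ℝ | ((|x - a| : ℝ) : EReal) < R}) (f : ℝ → ℝ)
    (m : Fin k → ℕ) (hm : StrictMono m)
    (hdiff : ContDiffWithinAt ℝ (m ⟨k - 1, by omega⟩) f I a)
    (hnz : ∀ i : Fin k, iteratedDerivWithin (m i) f I a ≠ 0) :
    ∃ u : Fin n → ℝ, (∀ i j, a + u i * u j ∈ I) ∧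
      k ≤ (Matrix.of fun i j => f (a + u i * u j)).rank := by
  have hIn : I ∈ 𝓝 a := by
    rw [hI]
    apply IsOpen.mem_nhds
    · exact isOpen_lt (continuous_coe_real_ereal.comp (by fun_prop)) continuous_const
    · simpa using hR
  obtain ⟨m', hinj, hP, N, hmN, hNM, hall⟩ :=
    first_k (fun j => iteratedDerivWithin j f I a ≠ 0) hk1 m hm hnz
  have hT := taylor_within_at f I a hIn N (hdiff.of_le (by exact_mod_cast hNM))
  have hdet := core_det (fun x => f (a + x)) m' hinj
    (fun p => ((m' p).factorial : ℝ)⁻¹ * iteratedDerivWithin (m' p) f I a)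
    (fun p => mul_ne_zero (by positivity) (hP p)) N hmN (by
      refine hT.congr_left fun x => ?_
      congr 1
      rw [← Finset.sum_image (s := Finset.univ) (g := m')
        (f := fun j => ((j.factorial : ℝ)⁻¹ * iteratedDerivWithin j f I a) * x ^ j)
        (fun p _ q _ h => hinj h)]
      symm
      apply Finset.sum_subset
      · intro j hj
        obtain ⟨p, -, rfl⟩ := Finset.mem_image.mp hj
        exact Finset.mem_range.mpr (Nat.lt_succ_of_le (hmN p))
      · intro j hj hj'
        by_contra h
        apply hj'
        obtain ⟨i, hi⟩ := hall j (Nat.lt_succ_iff.mp (Finset.mem_range.mp hj))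
          (fun h0 => h (by simp [h0]))
        exact Finset.mem_image.mpr ⟨i, Finset.mem_univ _, hi⟩)
  let u : ℝ → Fin n → ℝ := fun t i => t * 2 ^ (i : ℕ)
  have hmem : ∀ᶠ t in 𝓝[>] (0 : ℝ), ∀ i j, a + u t i * u t j ∈ I := by
    rw [eventually_all]; intro i
    rw [eventually_all]; intro j
    have hc : Continuous fun t : ℝ => a + u t i * u t j := by
      simp only [u]; fun_prop
    have h := hc.tendsto 0
    simp only [u, zero_mul, add_zero] at h
    exact (h.mono_left nhdsWithin_le_nhds).eventually hIn
  obtain ⟨t, ht1, ht2⟩ := (hdet.and hmem).exists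
  refine ⟨u t, ht2, ?_⟩
  have hr := rank_submatrix_le (Matrix.of fun i j => f (a + u t i * u t j))
    (Fin.castLE hkn) (Fin.castLE hkn)
  refine le_trans ?_ hr
  have hsub : (Matrix.of fun i j => f (a + u t i * u t j)).submatrix
      (Fin.castLE hkn) (Fin.castLE hkn) = Matrix.of fun i j : Fin k =>
        f (a + (t * 2 ^ (i : ℕ)) * (t * 2 ^ (j : ℕ))) := by
    ext i j; simp [u]
  rw [hsub, rank_of_isUnit]
  · simp
  · rw [isUnit_iff_isUnit_det]
    exact isUnit_iff_ne_zero.mpr ht1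
end

section
/- Fix 0 < R ≤ ∞ and integers n, l, k with 2 < l < k < min(2l, n−1). Let I = [0,R) or I = (-R,R), and let f : I → ℝ be continuous. Then the following are equivalent: (1) f[A] ∈ S_n^k for every n×n real symmetric matrix A of rank at most l with entries in I; (2) f[A] ∈ S_n^k for every A ∈ P_n^l(I); (3) there exists c_1 ∈ ℝ such that f(x) = f(0) + c_1 x for all x ∈ I. Moreover, f[A] ∈ P_n^k for every A ∈ P_n^l(I) if and only if f(0) ≥ 0 and f(x) = f(0) + c_1 x on I for some c_1 ≥ 0. Also, when I = [0,R) and k ≤ n−3, the statement 'f[A] ∈ P_n^k for every A ∈ P_n^l(I) if and only if f(0) ≥ 0 and f(x) = f(0) + c_1 x on I for some c_1 ≥ 0' holds for arbitrary f : I → ℝ, without the continuity assumption. -/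
open Matrix Set

def RkHyp (n k l : ℕ) (I : Set ℝ) (f : ℝ → ℝ) : Prop :=
  ∀ A : Matrix (Fin n) (Fin n) ℝ, A.PosSemidef → A.rank ≤ l → (∀ i j, A i j ∈ I) →
    (A.map f).rank ≤ k

lemma rk_gram {n k l : ℕ} {I : Set ℝ} {f : ℝ → ℝ} (h0 : (0:ℝ) ∈ I) (H : RkHyp n k l I f)
    {ι κ : Type} [Fintype ι] [Fintype κ] (hι : Fintype.card ι ≤ n) (hκ : Fintype.card κ ≤ l)
    (V : Matrix ι κ ℝ) (hV : ∀ i j, (V * Vᵀ) i j ∈ I) : ((V * Vᵀ).map f).rank ≤ k := by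
  classical
  obtain ⟨emb⟩ : Nonempty (ι ↪ Fin n) :=
    Function.Embedding.nonempty_of_card_le (by simpa using hι)
  let V' : Matrix (Fin n) κ ℝ := Matrix.of (Function.extend emb (V : ι → κ → ℝ) (0 : Fin n → κ → ℝ))
  have hV1 : ∀ i, V' (emb i) = V i := fun i => emb.injective.extend_apply (V : ι → κ → ℝ) (0 : Fin n → κ → ℝ) i
  have hV2 : ∀ x, (¬ ∃ i, emb i = x) → V' x = 0 := fun x hx => Function.extend_apply' (V : ι → κ → ℝ) (0 : Fin n → κ → ℝ) x hx
  have hE : ∀ i j, (V' * V'ᵀ) (emb i) (emb j) = (V * Vᵀ) i j := by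
    intro i j
    simp only [Matrix.mul_apply, Matrix.transpose_apply, hV1]
  have := H (V' * V'ᵀ) (by simpa using Matrix.posSemidef_self_mul_conjTranspose V')
    ((Matrix.rank_mul_le_left _ _).trans ((Matrix.rank_le_card_width V').trans hκ)) (by
      intro x y
      by_cases hx : ∃ i, emb i = x
      · by_cases hy : ∃ i, emb i = y
        · obtain ⟨i, rfl⟩ := hx
          obtain ⟨j, rfl⟩ := hy
          rw [hE]; exact hV i j
        · simpa [Matrix.mul_apply, hV2 y hy] using h0
      · simpa [Matrix.mul_apply, hV2 x hx] using h0)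
  have e : (V * Vᵀ).map f = ((V' * V'ᵀ).map f).submatrix emb emb := by
    ext i j
    simp [hE]
  rw [e]
  exact (Matrix.rank_submatrix_le _ _ _).trans this

lemma rank_add_le_aux {ι : Type} [Fintype ι] (A B : Matrix ι ι ℝ) :
    (A + B).rank ≤ A.rank + B.rank := by
  unfold Matrix.rank
  rw [Matrix.mulVecLin_add]
  exact (Submodule.finrank_mono (LinearMap.range_add_le _ _)).trans
    (Submodule.finrank_add_le_finrank_add_finrank _ _)

lemma det_zero_of_rank {ι : Type} [Fintype ι] [DecidableEq ι] (M : Matrix ι ι ℝ)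
    (h : M.rank < Fintype.card ι) : M.det = 0 := by
  by_contra hd
  have := Matrix.rank_of_isUnit M ((Matrix.isUnit_iff_isUnit_det M).2 (isUnit_iff_ne_zero.2 hd))
  omega

lemma gram_sing {n k l : ℕ} {I : Set ℝ} {f g : ℝ → ℝ} (h0 : (0:ℝ) ∈ I) (H : RkHyp n k l I f)
    (hkn : k + 2 ≤ n) (hg : ∀ x, g x = f x - f 0)
    {ι κ : Type} [Fintype ι] [Fintype κ] [DecidableEq ι]
    (hι : Fintype.card ι = k + 1 ∨ Fintype.card ι = k + 2) (hκ : Fintype.card κ ≤ l)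
    (V : Matrix ι κ ℝ) (hV : ∀ i j, (V * Vᵀ) i j ∈ I) :
    ∃ x : ι → ℝ, x ≠ 0 ∧ ∀ i, ∑ j, g ((V * Vᵀ) i j) * x j = 0 := by
  classical
  have key : ((V * Vᵀ).map g).det = 0 → ∃ x : ι → ℝ, x ≠ 0 ∧
      ∀ i, ∑ j, g ((V * Vᵀ) i j) * x j = 0 := by
    intro h
    obtain ⟨x, hx, hx'⟩ := Matrix.exists_mulVec_eq_zero_iff.2 h
    refine ⟨x, hx, fun i => ?_⟩
    have := congrFun hx' i
    simpa [Matrix.mulVec, dotProduct] using this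
  rcases hι with hι | hι
  · by_cases hf : f 0 = 0
    · apply key
      apply det_zero_of_rank
      have : g = f := by ext x; simp [hg, hf]
      rw [this, hι]
      have := rk_gram h0 H (by omega) hκ V hV
      omega
    · let V' : Matrix (Option ι) κ ℝ := Matrix.of fun o => o.elim 0 V
      have hn : V' none = 0 := rfl
      have hs : ∀ i, V' (some i) = V i := fun i => rfl
      have hss : ∀ i j, (V' * V'ᵀ) (some i) (some j) = (V * Vᵀ) i j := fun i j => by
        simp only [Matrix.mul_apply, Matrix.transpose_apply, hs]
      have hnx : ∀ j, (V' * V'ᵀ) none j = 0 := fun j => by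
        simp [Matrix.mul_apply, Matrix.transpose_apply, hn]
      have hxn : ∀ j, (V' * V'ᵀ) j none = 0 := fun j => by
        simp [Matrix.mul_apply, Matrix.transpose_apply, hn]
      have r := rk_gram h0 H (by simp; omega) hκ V' (by
        rintro (_ | i) (_ | j)
        · rw [hnx]; exact h0
        · rw [hnx]; exact h0
        · rw [hxn]; exact h0
        · rw [hss]; exact hV i j)
      have d := det_zero_of_rank _ (lt_of_le_of_lt r (by simp; omega))
      obtain ⟨x, hx, hx'⟩ := Matrix.exists_mulVec_eq_zero_iff.2 d
      have r1 := congrFun hx' none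
      have r2 := fun i => congrFun hx' (some i)
      simp only [Matrix.mulVec, dotProduct, Fintype.sum_option, Matrix.map_apply, hnx, hxn, hss,
        Pi.zero_apply] at r1 r2
      rw [← Finset.mul_sum, ← mul_add] at r1
      have r3 : x none + ∑ i, x (some i) = 0 := (mul_eq_zero.1 r1).resolve_left hf
      have r4 : ∀ i, ∑ j, g ((V * Vᵀ) i j) * x (some j) = 0 := by
        intro i
        simp only [hg, sub_mul, Finset.sum_sub_distrib, ← Finset.mul_sum]
        linear_combination r2 i - r1
      refine ⟨fun i => x (some i), ?_, r4⟩
      intro h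
      apply hx
      have h' : ∀ i, x (some i) = 0 := fun i => congrFun h i
      ext (_ | i)
      · simpa [h'] using r3
      · exact h' i
  · apply key
    apply det_zero_of_rank
    have r := rk_gram h0 H (by omega) hκ V hV
    have e : (V * Vᵀ).map g = (V * Vᵀ).map f + Matrix.vecMulVec (fun _ => -f 0) (fun _ => 1) := by
      ext i j
      simp [hg, Matrix.vecMulVec_apply, sub_eq_add_neg]
    rw [e]
    have r1 := rank_add_le_aux ((V * Vᵀ).map f)
      (Matrix.vecMulVec (fun _ : ι => -f 0) (fun _ : ι => (1:ℝ)))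
    have r2 := Matrix.rank_vecMulVec_le (fun _ : ι => -f 0) (fun _ : ι => (1:ℝ))
    omega

/-- The main source of equations. -/
lemma star {n k l m e : ℕ} {I : Set ℝ} {f g : ℝ → ℝ} (h0 : (0:ℝ) ∈ I) (H : RkHyp n k l I f)
    (hkn : k + 2 ≤ n) (hg : ∀ x, g x = f x - f 0) (hm : m ≤ l)
    (hme : m + e = k + 1 ∨ m + e = k + 2)
    (a : Fin m → ℝ) (w : Fin e → Fin m → ℝ)
    (h1 : ∀ i, a i * a i ∈ I) (h2 : ∀ p i, a i * w p i ∈ I)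
    (h3 : ∀ p q, ∑ i, w p i * w q i ∈ I) :
    ∃ (x : Fin m → ℝ) (y : Fin e → ℝ), ¬ (x = 0 ∧ y = 0) ∧
      (∀ i, g (a i * a i) * x i + ∑ p, g (a i * w p i) * y p = 0) ∧
      (∀ p, ∑ i, g (a i * w p i) * x i + ∑ q, g (∑ i, w p i * w q i) * y q = 0) := by
  classical
  have g0 : g 0 = 0 := by simp [hg]
  let V : Matrix (Fin m ⊕ Fin e) (Fin m) ℝ := Matrix.of (Sum.elim (Matrix.diagonal a) w)
  have vl : ∀ i j, V (Sum.inl i) j = if i = j then a i else 0 := fun i j => rfl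
  have vr : ∀ p j, V (Sum.inr p) j = w p j := fun p j => rfl
  have v1 : ∀ i j, (V * Vᵀ) (Sum.inl i) (Sum.inl j) = if i = j then a i * a i else 0 := by
    intro i j
    by_cases h : i = j
    · subst h
      simp [vl, vr, Matrix.mul_apply]
    · simp [vl, vr, Matrix.mul_apply, h, Ne.symm h]
  have v2 : ∀ i p, (V * Vᵀ) (Sum.inl i) (Sum.inr p) = a i * w p i := by
    intro i p
    simp [vl, vr, Matrix.mul_apply]
  have v3 : ∀ i p, (V * Vᵀ) (Sum.inr p) (Sum.inl i) = a i * w p i := by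
    intro i p
    simp [vl, vr, Matrix.mul_apply, mul_comm]
  have v4 : ∀ p q, (V * Vᵀ) (Sum.inr p) (Sum.inr q) = ∑ i, w p i * w q i := by
    intro i p
    simp [vl, vr, Matrix.mul_apply]
  obtain ⟨z, hz, hz'⟩ := gram_sing h0 H hkn hg (ι := Fin m ⊕ Fin e) (κ := Fin m)
    (by simpa using hme) (by simpa using hm) V (by
      rintro (i | p) (j | q)
      · rw [v1]; split_ifs
        · exact h1 i
        · exact h0
      · rw [v2]; exact h2 _ _
      · rw [v3]; exact h2 _ _
      · rw [v4]; exact h3 _ _)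
  refine ⟨fun i => z (Sum.inl i), fun p => z (Sum.inr p), ?_, ?_, ?_⟩
  · rintro ⟨ha, hb⟩
    apply hz
    ext (i | p)
    · exact congrFun ha i
    · exact congrFun hb p
  · intro i
    have := hz' (Sum.inl i)
    rw [Fintype.sum_sum_type] at this
    simp only [v1, v2] at this
    rw [← this]
    congr 1
    rw [Finset.sum_eq_single i]
    · simp
    · intro b _ hb
      simp [Ne.symm hb, g0]
    · simp
  · intro p
    have := hz' (Sum.inr p)
    rw [Fintype.sum_sum_type] at this
    simpa only [v3, v4] using this

/-- Schur complement version. -/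
lemma star_schur {n k l e : ℕ} {I : Set ℝ} {f g : ℝ → ℝ} (h0 : (0:ℝ) ∈ I) (H : RkHyp n k l I f)
    (hkn : k + 2 ≤ n) (hg : ∀ x, g x = f x - f 0)
    (hme : l + e = k + 1)
    (a : ℝ) (w : Fin e → Fin l → ℝ) (hA : g (a * a) ≠ 0)
    (h1 : a * a ∈ I) (h2 : ∀ p i, a * w p i ∈ I)
    (h3 : ∀ p q, ∑ i, w p i * w q i ∈ I) :
    ∃ (y : Fin e → ℝ), y ≠ 0 ∧
      ∀ p, ∑ q, (g (a * a) * g (∑ i, w p i * w q i)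
        - ∑ i, g (a * w p i) * g (a * w q i)) * y q = 0 := by
  obtain ⟨x, y, hxy, e1, e2⟩ := star h0 H hkn hg le_rfl (Or.inl hme) (fun _ => a) w
    (fun _ => h1) h2 h3
  refine ⟨y, ?_, ?_⟩
  · rintro rfl
    apply hxy
    refine ⟨?_, rfl⟩
    ext i
    have := e1 i
    simpa [hA] using this
  · intro p
    have s1 : ∑ q, (g (a * a) * g (∑ i, w p i * w q i)
        - ∑ i, g (a * w p i) * g (a * w q i)) * y q
        = g (a * a) * ∑ q, g (∑ i, w p i * w q i) * y q
          - ∑ i, g (a * w p i) * ∑ q, g (a * w q i) * y q := by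
      simp only [sub_mul, Finset.sum_sub_distrib, Finset.mul_sum, Finset.sum_mul]
      rw [Finset.sum_comm (s := (Finset.univ : Finset (Fin e)))]
      simp only [mul_assoc]
    have s2 : ∑ i, g (a * w p i) * ∑ q, g (a * w q i) * y q
        = - (g (a * a) * ∑ i, g (a * w p i) * x i) := by
      rw [Finset.mul_sum, ← Finset.sum_neg_distrib]
      refine Finset.sum_congr rfl fun i _ => ?_
      linear_combination g (a * w p i) * e1 i
    rw [s1, s2]
    linear_combination g (a * a) * e2 p

structure Ctx (n k l e : ℕ) (I : Set ℝ) (f g : ℝ → ℝ) : Prop where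
  h0 : (0:ℝ) ∈ I
  hdown : ∀ x ∈ I, ∀ y, 0 ≤ y → y ≤ x → y ∈ I
  hup : ∀ x ∈ I, ∃ z ∈ I, x < z
  H : RkHyp n k l I f
  hkn : k + 2 ≤ n
  hg : ∀ x, g x = f x - f 0
  hle : l + e = k + 1
  he2 : 2 ≤ e
  hel : e ≤ l
  hl : 3 ≤ l

namespace Ctx
variable {n k l e : ℕ} {I : Set ℝ} {f g : ℝ → ℝ}

lemma g0 (C : Ctx n k l e I f g) : g 0 = 0 := by simp [C.hg]

lemma two_by_two (C : Ctx n k l e I f g) {d a b : ℝ} (hd : d * d ∈ I) (hgd : g (d * d) ≠ 0)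
    (ha : a * a ∈ I) (hb : b * b ∈ I) (hab : a * b ∈ I) :
    g (a * a) * g (b * b) = g (a * b) ^ 2 := by
  by_contra hne
  have hinj : ∀ p q : Fin e, Fin.castLE C.hel p = Fin.castLE C.hel q ↔ p = q := fun p q =>
    (Fin.castLE_injective C.hel).eq_iff
  have hs : ∀ p q : Fin e, ∑ i : Fin l, (if i = Fin.castLE C.hel p then b else 0) *
      (if i = Fin.castLE C.hel q then b else 0) = if p = q then b * b else 0 := by
    intro p q
    by_cases h : p = q
    · simp [h]
    · have h' : ¬ q = p := fun h' => h h'.symm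
      simp [hinj, h, h']
  obtain ⟨x, y, hxy, e1, e2⟩ := star C.h0 C.H C.hkn C.hg le_rfl (Or.inl C.hle)
    (fun i => if i.val < e then a else d) (fun p i => if i = Fin.castLE C.hel p then b else 0)
    (by
      intro i
      split_ifs <;> assumption)
    (by
      intro p i
      split_ifs with h1 h2 h2
      · exact hab
      · simpa using C.h0
      · exact absurd (by rw [h2]; simp) h1
      · simpa using C.h0)
    (by
      intro p q
      rw [hs]; split_ifs
      · exact hb
      · exact C.h0)
  have f1 : ∀ p : Fin e, g (a * a) * x (Fin.castLE C.hel p) + g (a * b) * y p = 0 := by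
    intro p
    have := e1 (Fin.castLE C.hel p)
    rw [Finset.sum_eq_single p] at this
    · simpa using this
    · intro q _ hq
      simp [hinj, Ne.symm hq, C.g0]
    · simp
  have f2 : ∀ p : Fin e, g (a * b) * x (Fin.castLE C.hel p) + g (b * b) * y p = 0 := by
    intro p
    have := e2 p
    rw [Finset.sum_eq_single (Fin.castLE C.hel p), Finset.sum_eq_single p] at this
    · rw [hs] at this
      simpa using this
    · intro q _ hq
      rw [hs]
      simp [Ne.symm hq, C.g0]
    · simp
    · intro i _ hi
      simp [hi, C.g0]
    · simp
  have f3 : ∀ i : Fin l, ¬ i.val < e → x i = 0 := by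
    intro i hi
    have := e1 i
    rw [Finset.sum_eq_zero] at this
    · simpa [hi, hgd] using this
    · intro q _
      have : i ≠ Fin.castLE C.hel q := by
        rintro rfl
        apply hi; simp
      simp [this, C.g0]
  have hne' : g (a * a) * g (b * b) - g (a * b) ^ 2 ≠ 0 := sub_ne_zero.2 hne
  apply hxy
  constructor
  · ext i
    by_cases hi : i.val < e
    · have h1 := f1 ⟨i.val, hi⟩
      have h2 := f2 ⟨i.val, hi⟩
      have hc : Fin.castLE C.hel ⟨i.val, hi⟩ = i := rfl
      rw [hc] at h1 h2
      have : (g (a * a) * g (b * b) - g (a * b) ^ 2) * x i = 0 := by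
        linear_combination g (b * b) * h1 - g (a * b) * h2
      exact (mul_eq_zero.1 this).resolve_left hne'
    · exact f3 i hi
  · ext p
    have : (g (a * a) * g (b * b) - g (a * b) ^ 2) * y p = 0 := by
      linear_combination g (a * a) * f2 p - g (a * b) * f1 p
    exact (mul_eq_zero.1 this).resolve_left hne'

lemma mul_mem (C : Ctx n k l e I f g) {a b : ℝ} (ha0 : 0 ≤ a) (hb0 : 0 ≤ b)
    (ha : a * a ∈ I) (hb : b * b ∈ I) : a * b ∈ I := by
  rcases le_total a b with h | h
  · exact C.hdown _ hb _ (by positivity) (by nlinarith)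
  · exact C.hdown _ ha _ (by positivity) (by nlinarith)

lemma same_sign (C : Ctx n k l e I f g) {d : ℝ} (hd : d * d ∈ I) (hgd : g (d * d) ≠ 0)
    {u v : ℝ} (hu0 : 0 ≤ u) (hv0 : 0 ≤ v) (hu : u ∈ I) (hv : v ∈ I) : 0 ≤ g u * g v := by
  have h1 := Real.mul_self_sqrt hu0
  have h2 := Real.mul_self_sqrt hv0
  have := C.two_by_two hd hgd (a := √u) (b := √v) (by rwa [h1]) (by rwa [h2])
    (C.mul_mem (Real.sqrt_nonneg _) (Real.sqrt_nonneg _) (by rwa [h1]) (by rwa [h2]))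
  rw [h1, h2] at this
  rw [this]; positivity

lemma mult (C : Ctx n k l e I f g) {a x y : ℝ} (ha : a * a ∈ I) (hga : g (a * a) ≠ 0)
    (ha0 : 0 ≤ a) (hx0 : 0 ≤ x) (hy0 : 0 ≤ y) (hx : x * x ∈ I) (hy : y * y ∈ I) :
    g (a * a) * g (x * y) = g (a * x) * g (a * y) := by
  have mxy := C.mul_mem hx0 hy0 hx hy
  have max' := C.mul_mem ha0 hx0 ha hx
  have may := C.mul_mem ha0 hy0 ha hy
  have h1 := C.two_by_two ha hga hx hy mxy
  have h2 := C.two_by_two ha hga ha hx max'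
  have h3 := C.two_by_two ha hga ha hy may
  have s1 := C.same_sign ha hga (mul_nonneg ha0 ha0) (mul_nonneg hx0 hy0) ha mxy
  have s2 := C.same_sign ha hga (mul_nonneg ha0 hx0) (mul_nonneg ha0 hy0) max' may
  have : (g (a * a) * g (x * y)) ^ 2 = (g (a * x) * g (a * y)) ^ 2 := by
    rw [mul_pow, mul_pow, ← h1, ← h2, ← h3]; ring
  exact (pow_left_inj₀ s1 s2 two_ne_zero).1 this

lemma additive_sq (C : Ctx n k l e I f g) {a b c : ℝ} (ha : a * a ∈ I) (hga : g (a * a) ≠ 0)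
    (ha0 : 0 ≤ a) (hb0 : 0 ≤ b) (hc0 : 0 ≤ c) (hbc : b * b + c * c ∈ I) :
    g (b * b + c * c) = g (b * b) + g (c * c) := by
  have hb : b * b ∈ I := C.hdown _ hbc _ (by positivity) (by nlinarith)
  have hc : c * c ∈ I := C.hdown _ hbc _ (by positivity) (by nlinarith)
  haveI : NeZero l := ⟨by have := C.hl; omega⟩
  have hl := C.hl
  let s : Fin e → Fin l := Fin.castLE C.hel
  have hinj : Function.Injective s := Fin.castLE_injective C.hel
  let nx : Fin l → Fin l := fun i => ⟨(i.val + 1) % l, Nat.mod_lt _ (by omega)⟩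
  have nxv : ∀ i : Fin l, (i.val + 1 < l ∧ (nx i).val = i.val + 1) ∨
      (i.val + 1 = l ∧ (nx i).val = 0) := by
    intro i
    have := i.isLt
    by_cases h : i.val + 1 < l
    · left; exact ⟨h, Nat.mod_eq_of_lt h⟩
    · right
      have h' : i.val + 1 = l := by omega
      exact ⟨h', by simp [nx, h']⟩
  have hn1 : ∀ i, nx i ≠ i := by
    intro i h
    have h' : (nx i).val = i.val := by rw [h]
    have := nxv i; omega
  have hn2 : ∀ i, nx (nx i) ≠ i := by
    intro i h
    have h' : (nx (nx i)).val = i.val := by rw [h]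
    have := nxv i; have := nxv (nx i); omega
  have hn3 : Function.Injective nx := by
    intro i j h
    have h' : (nx i).val = (nx j).val := by rw [h]
    have := nxv i; have := nxv j
    have := i.isLt; have := j.isLt
    ext; omega
  let w : Fin e → Fin l → ℝ := fun p i => if i = s p then b else if i = nx (s p) then c else 0
  have w1 : ∀ p, w p (s p) = b := fun p => by simp [w]
  have w2 : ∀ p, w p (nx (s p)) = c := fun p => by simp [w, hn1]
  have w3 : ∀ p i, i ≠ s p → i ≠ nx (s p) → w p i = 0 := fun p i h1 h2 => by simp [w, h1, h2]
  have wn : ∀ p i, 0 ≤ w p i ∧ w p i * w p i ∈ I := by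
    intro p i
    simp only [w]
    split_ifs
    · exact ⟨hb0, hb⟩
    · exact ⟨hc0, hc⟩
    · exact ⟨le_rfl, by simpa using C.h0⟩
  have dsum : ∀ (F : ℝ → ℝ), F 0 = 0 → ∀ p, ∑ i, F (w p i) = F b + F c := by
    intro F hF p
    rw [← Finset.sum_subset (Finset.subset_univ {s p, nx (s p)}),
      Finset.sum_pair (hn1 (s p)).symm, w1, w2]
    intro i _ hi
    simp only [Finset.mem_insert, Finset.mem_singleton, not_or] at hi
    rw [w3 p i hi.1 hi.2, hF]
  have off : ∀ p q, p ≠ q → ∃ i0, ∀ i, i ≠ i0 → w p i = 0 ∨ w q i = 0 := by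
    intro p q hpq
    have hsp : s p ≠ s q := fun h => hpq (hinj h)
    have hnp : nx (s p) ≠ nx (s q) := fun h => hsp (hn3 h)
    by_cases h : s q = nx (s p)
    · refine ⟨s q, fun i hi => ?_⟩
      by_cases h1 : i = s p
      · right
        refine w3 _ _ hi ?_
        rw [h1, h]; exact (hn2 _).symm
      · left
        exact w3 _ _ h1 (h ▸ hi)
    · refine ⟨s p, fun i hi => ?_⟩
      by_cases h1 : i = nx (s p)
      · right
        refine w3 _ _ ?_ ?_
        · rw [h1]; exact Ne.symm h
        · rw [h1]; exact hnp
      · left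
        exact w3 _ _ hi h1
  have offsum : ∀ p q, p ≠ q → ∃ i0, ∑ i, w p i * w q i = w p i0 * w q i0 ∧
      ∑ i, g (a * w p i) * g (a * w q i) = g (a * w p i0) * g (a * w q i0) := by
    intro p q hpq
    obtain ⟨i0, hi0⟩ := off p q hpq
    refine ⟨i0, Finset.sum_eq_single i0 ?_ (by simp), Finset.sum_eq_single i0 ?_ (by simp)⟩
    · intro i _ hi
      rcases hi0 i hi with h | h <;> simp [h]
    · intro i _ hi
      rcases hi0 i hi with h | h <;> simp [h, C.g0]
  have diag : ∀ p, ∑ i, w p i * w p i = b * b + c * c :=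
    fun p => dsum (fun t => t * t) (by simp) p
  obtain ⟨y, hy, hy'⟩ := star_schur C.h0 C.H C.hkn C.hg C.hle a w hga ha
    (fun p i => C.mul_mem ha0 (wn p i).1 ha (wn p i).2)
    (by
      intro p q
      by_cases hpq : p = q
      · subst hpq
        rw [diag]; exact hbc
      · obtain ⟨i0, h, -⟩ := offsum p q hpq
        rw [h]
        exact C.mul_mem (wn p i0).1 (wn q i0).1 (wn p i0).2 (wn q i0).2)
  obtain ⟨p, hp⟩ := Function.ne_iff.1 hy
  have := hy' p
  rw [Finset.sum_eq_single p] at this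
  · have h1 := (mul_eq_zero.1 this).resolve_right hp
    rw [diag, dsum (fun t => g (a * t) * g (a * t)) (by simp [C.g0]) p,
      ← C.mult ha hga ha0 hb0 hb0 hb hb, ← C.mult ha hga ha0 hc0 hc0 hc hc] at h1
    have h2 : g (a * a) * (g (b * b + c * c) - (g (b * b) + g (c * c))) = 0 := by
      linear_combination h1
    exact sub_eq_zero.1 ((mul_eq_zero.1 h2).resolve_left hga)
  · intro q _ hq
    obtain ⟨i0, h, h'⟩ := offsum p q hq.symm
    rw [h, h', C.mult ha hga ha0 (wn p i0).1 (wn q i0).1 (wn p i0).2 (wn q i0).2]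
    simp
  · simp

end Ctx

/-- Additive and nonnegative implies linear. -/
lemma lin_of_additive {I : Set ℝ} {g : ℝ → ℝ}
    (hdown : ∀ x ∈ I, ∀ y, 0 ≤ y → y ≤ x → y ∈ I)
    (hadd : ∀ x y, 0 ≤ x → 0 ≤ y → x + y ∈ I → g (x + y) = g x + g y)
    (hpos : ∀ x ∈ I, 0 ≤ x → 0 ≤ g x) {x y : ℝ} (hx : x ∈ I) (hy : y ∈ I) (hx0 : 0 < x)
    (hy0 : 0 < y) : g x * y ≤ g y * x := by
  have hmono : ∀ u v, 0 ≤ u → u ≤ v → v ∈ I → g u ≤ g v := by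
    intro u v hu huv hv
    have h1 := hadd u (v - u) hu (by linarith) (by simpa using hv)
    have h2 := hpos (v - u) (hdown _ hv _ (by linarith) (by linarith)) (by linarith)
    rw [add_sub_cancel] at h1
    linarith
  have hmul : ∀ (m : ℕ) (z : ℝ), 0 ≤ z → ((m + 1 : ℕ) : ℝ) * z ∈ I →
      g (((m + 1 : ℕ) : ℝ) * z) = ((m + 1 : ℕ) : ℝ) * g z := by
    intro m z hz
    induction m with
    | zero => simp
    | succ m ih =>
      intro h
      have h1 := ih (hdown _ h _ (by positivity) (by push_cast; nlinarith))
      have e : (((m + 1 + 1 : ℕ)) : ℝ) * z = ((m + 1 : ℕ) : ℝ) * z + z := by push_cast; ring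
      rw [e] at h ⊢
      rw [hadd _ _ (by positivity) hz h, h1]
      push_cast; ring
  have key : ∀ N : ℕ, g x * y - g x * x / ((N : ℝ) + 1) ≤ g y * x := by
    intro N
    have hN : (0:ℝ) < (N:ℝ) + 1 := by positivity
    set z := x / ((N:ℝ) + 1) with hz
    have hz0 : 0 < z := by positivity
    have hxz : ((N + 1 : ℕ) : ℝ) * z = x := by rw [hz]; push_cast; field_simp
    have h1 := hmul N z hz0.le (by rwa [hxz])
    rw [hxz] at h1
    push_cast at h1 hxz
    have hgz : 0 ≤ g z := hpos z (hdown _ hx _ hz0.le (by rw [← hxz]; nlinarith [(N.cast_nonneg : (0:ℝ) ≤ N)])) hz0.le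
    have hm1 := Nat.floor_le (show 0 ≤ y / z by positivity)
    have hm2 := Nat.lt_floor_add_one (y / z)
    rw [le_div_iff₀ hz0] at hm1
    rw [div_lt_iff₀ hz0] at hm2
    have h3 : ((⌊y / z⌋₊ : ℕ) : ℝ) * g z ≤ g y := by
      rcases Nat.eq_zero_or_pos ⌊y / z⌋₊ with h | h
      · rw [h]; simpa using hpos y hy hy0.le
      · obtain ⟨m, hm⟩ := Nat.exists_eq_succ_of_ne_zero h.ne'
        rw [hm] at hm1 ⊢
        rw [← hmul m z hz0.le (hdown _ hy _ (by positivity) hm1)]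
        exact hmono _ _ (by positivity) hm1 hy
    set M : ℝ := ((⌊y / z⌋₊ : ℕ) : ℝ)
    have e1 : g x * x / ((N : ℝ) + 1) = g x * z := by rw [hz]; ring
    rw [e1, ← mul_sub]
    have h4 : g x * (y - z) ≤ g x * (M * z) :=
      mul_le_mul_of_nonneg_left (by linarith) (hpos x hx hx0.le)
    have h5 : g x * (M * z) = M * g z * x := by rw [h1, ← hxz]; ring
    have h6 : M * g z * x ≤ g y * x := mul_le_mul_of_nonneg_right h3 hx0.le
    linarith
  have lim : Filter.Tendsto (fun N : ℕ => g x * y - g x * x / ((N : ℝ) + 1)) Filter.atTop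
      (nhds (g x * y - 0)) := by
    apply Filter.Tendsto.sub tendsto_const_nhds
    have := (tendsto_one_div_add_atTop_nhds_zero_nat (𝕜 := ℝ)).const_mul (g x * x)
    simpa [div_eq_mul_inv] using this
  have := le_of_tendsto' lim key
  linarith

namespace Ctx
variable {n k l e : ℕ} {I : Set ℝ} {f g : ℝ → ℝ}

lemma lin_pos (C : Ctx n k l e I f g) : ∃ c, ∀ x ∈ I, 0 ≤ x → g x = c * x := by
  by_cases hz : ∀ x ∈ I, 0 ≤ x → g x = 0
  · exact ⟨0, fun x hx h => by simp [hz x hx h]⟩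
  push Not at hz
  obtain ⟨u, hu, hu0, hgu⟩ := hz
  have hu1 := Real.mul_self_sqrt hu0
  have ha : √u * √u ∈ I := by rwa [hu1]
  have hga : g (√u * √u) ≠ 0 := by rwa [hu1]
  have hadd : ∀ x y, 0 ≤ x → 0 ≤ y → x + y ∈ I → g (x + y) = g x + g y := by
    intro x y hx hy hxy
    have h1 := Real.mul_self_sqrt hx
    have h2 := Real.mul_self_sqrt hy
    have := C.additive_sq (b := √x) (c := √y) ha hga (Real.sqrt_nonneg _) (Real.sqrt_nonneg _)
      (Real.sqrt_nonneg _) (by rwa [h1, h2])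
    rwa [h1, h2] at this
  have hupos : 0 < u := by
    rcases hu0.lt_or_eq with h | h
    · exact h
    · exact absurd (by rw [← h]; exact C.g0) hgu
  have hadd' : ∀ x y, 0 ≤ x → 0 ≤ y → x + y ∈ I → g u * g (x + y) = g u * g x + g u * g y := by
    intro x y hx hy hxy
    rw [hadd x y hx hy hxy]; ring
  have hpos : ∀ x ∈ I, 0 ≤ x → 0 ≤ g u * g x := fun x hx h =>
    C.same_sign ha hga hu0 h hu hx
  refine ⟨g u / u, fun x hx hx0 => ?_⟩
  rcases hx0.lt_or_eq with h | h
  · have h1 := lin_of_additive (g := fun x => g u * g x) C.hdown hadd' hpos hu hx hupos h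
    have h2 := lin_of_additive (g := fun x => g u * g x) C.hdown hadd' hpos hx hu h hupos
    have h3 : g u * (g u * x) = g u * (g x * u) := by linarith
    have h4 := mul_left_cancel₀ hgu h3
    field_simp
    linarith
  · rw [← h, C.g0]; simp

/-- Zero on the nonnegative part forces zero on the negative part. -/
lemma neg_zero_case (C : Ctx n k l e I f g) (hsym : ∀ x ∈ I, ∀ y, |y| ≤ |x| → y ∈ I)
    (hz : ∀ x ∈ I, 0 ≤ x → g x = 0) {x : ℝ} (hx0 : 0 < x) (hx : x ∈ I) : g (-x) = 0 := by
  by_contra hne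
  have hnx : -x ∈ I := hsym x hx _ (by simp)
  have h1 := Real.mul_self_sqrt hx0.le
  have h1' : √x * -√x = -x := by rw [mul_neg, h1]
  have hle := C.hle
  have hel := C.hel
  have hs : ∀ p q : Fin ((k + 2) / 2), ∑ i : Fin ((k + 2) / 2), (if i = p then -√x else 0) *
      (if i = q then -√x else 0) = if p = q then x else 0 := by
    intro p q
    by_cases h : p = q
    · simp [h, h1]
    · have h' : ¬ q = p := fun h' => h h'.symm
      simp [h, h']
  obtain ⟨X, Y, hXY, e1, e2⟩ := star C.h0 C.H C.hkn C.hg (m := (k + 2) / 2) (e := (k + 2) / 2)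
    (by omega) (by omega)
    (fun i => √x) (fun p i => if i = p then -√x else 0)
    (by
      intro i
      rwa [h1])
    (by
      intro p i
      split_ifs
      · rwa [h1']
      · simpa using C.h0)
    (by
      intro p q
      rw [hs]; split_ifs
      · exact hx
      · exact C.h0)
  have gx : g x = 0 := hz x hx hx0.le
  apply hXY
  constructor
  · ext p
    have := e2 p
    rw [Finset.sum_eq_single p, Finset.sum_eq_zero] at this
    · simpa [h1, hne] using this
    · intro q _
      rw [hs]
      split_ifs <;> simp [gx, C.g0]
    · intro i _ hi
      simp [hi, C.g0]
    · simp
  · ext p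
    have := e1 p
    rw [Finset.sum_eq_single p] at this
    · simpa [h1, hne, gx] using this
    · intro i _ hi
      simp [Ne.symm hi, C.g0]
    · simp

lemma neg_case (C : Ctx n k l e I f g) (hsym : ∀ x ∈ I, ∀ y, |y| ≤ |x| → y ∈ I)
    {c : ℝ} (hc : c ≠ 0) (hlin : ∀ x ∈ I, 0 ≤ x → g x = c * x) {x : ℝ} (hx0 : 0 < x)
    (hx : x ∈ I) : g (-x) = -(c * x) := by
  have sq : ∀ u ∈ I, 0 < u → g (-u) = c * u ∨ g (-u) = -(c * u) := by
    intro u hu hu0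
    have h1 := Real.mul_self_sqrt hu0.le
    have h2 := C.two_by_two (d := √u) (a := √u) (b := -√u) (by rwa [h1])
      (by rw [h1, hlin u hu hu0.le]; positivity) (by rwa [h1]) (by rwa [neg_mul_neg, h1])
      (by rw [mul_neg, h1]; exact hsym u hu _ (by simp))
    rw [neg_mul_neg, mul_neg, h1, hlin u hu hu0.le] at h2
    exact sq_eq_sq_iff_eq_or_eq_neg.1 (by rw [← h2]; ring)
  rcases sq x hx hx0 with hbad | h
  swap
  · exact h
  exfalso
  obtain ⟨z, hz, hxz⟩ := C.hup x hx
  have hl := C.hl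
  have hl' : (3:ℝ) ≤ l := by exact_mod_cast hl
  obtain ⟨t, ht0, rfl⟩ : ∃ t, 0 < t ∧ x = t * t :=
    ⟨√x, Real.sqrt_pos.2 hx0, (Real.mul_self_sqrt hx0.le).symm⟩
  obtain ⟨δ, hδ0, hδ1, hδ2⟩ : ∃ δ > 0, l * δ < t ∧ t * t + (l - 1) * (δ * δ) < z := by
    refine ⟨min (t / (2 * l)) ((z - t * t) / (2 * l * t)), ?_, ?_, ?_⟩
    · have : 0 < z - t * t := by linarith
      positivity
    · have h1 := min_le_left (t / (2 * l)) ((z - t * t) / (2 * l * t))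
      rw [le_div_iff₀ (by positivity)] at h1
      nlinarith
    · set δ := min (t / (2 * l)) ((z - t * t) / (2 * l * t))
      have hδ0 : 0 < δ := by
        have : 0 < z - t * t := by linarith
        positivity
      have h1 : δ ≤ _ := min_le_left (t / (2 * l)) ((z - t * t) / (2 * l * t))
      have h2 : δ ≤ _ := min_le_right (t / (2 * l)) ((z - t * t) / (2 * l * t))
      rw [le_div_iff₀ (by positivity)] at h1 h2
      have h3 : δ ≤ t := by nlinarith
      have h4 : l * (δ * δ) ≤ l * (δ * t) := by gcongr
      nlinarith [mul_pos hδ0 hδ0]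
  let s : Fin e → Fin l := Fin.castLE C.hel
  have hinj : Function.Injective s := Fin.castLE_injective C.hel
  let w : Fin e → Fin l → ℝ := fun p i => if i = s p then -t else δ
  have w1 : ∀ p, w p (s p) = -t := fun p => by simp [w]
  have w2 : ∀ p i, i ≠ s p → w p i = δ := fun p i h => by simp [w, h]
  have dsum : ∀ (F : ℝ → ℝ), ∀ p, ∑ i, F (w p i) = F (-t) + (l - 1) * F δ := by
    intro F p
    rw [← Finset.add_sum_erase _ _ (Finset.mem_univ (s p)), w1,
      Finset.sum_congr rfl (g := fun _ => F δ)
      (fun i hi => by rw [w2 p i (Finset.ne_of_mem_erase hi)])]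
    simp [Finset.card_erase_of_mem, Nat.cast_sub (show 1 ≤ l by omega)]
  have osum : ∀ (F : ℝ → ℝ → ℝ), ∀ p q, p ≠ q → ∑ i, F (w p i) (w q i) =
      F (-t) δ + F δ (-t) + (l - 2) * F δ δ := by
    intro F p q hpq
    have hne : s q ≠ s p := fun h => hpq (hinj h).symm
    have hm : s q ∈ (Finset.univ : Finset (Fin l)).erase (s p) := by simp [hne]
    rw [← Finset.add_sum_erase _ _ (Finset.mem_univ (s p)),
      ← Finset.add_sum_erase _ _ hm, w1, w1, w2 _ _ hne, w2 _ _ hne.symm,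
      Finset.sum_congr rfl (g := fun _ => F δ δ)
      (fun i hi => by
        rw [w2 p i (Finset.ne_of_mem_erase (Finset.mem_of_mem_erase hi)),
          w2 q i (Finset.ne_of_mem_erase hi)])]
    rw [Finset.sum_const, Finset.card_erase_of_mem hm, Finset.card_erase_of_mem (Finset.mem_univ _),
      Finset.card_univ, Fintype.card_fin, Nat.sub_sub, nsmul_eq_mul,
      Nat.cast_sub (show 1 + 1 ≤ l by omega)]
    push_cast
    ring
  set v : ℝ := 2 * t * δ - (l - 2) * (δ * δ) with hv
  have hv0 : 0 < v := by nlinarith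
  have hvx : v ≤ t * t := by nlinarith [sq_nonneg (t - δ), mul_pos hδ0 hδ0]
  have hvI : v ∈ I := C.hdown _ hx _ hv0.le hvx
  have diag : ∀ p, ∑ i, w p i * w p i = t * t + (l - 1) * (δ * δ) := fun p => by
    rw [dsum (fun u => u * u)]; ring
  have offd : ∀ p q, p ≠ q → ∑ i, w p i * w q i = -v := fun p q h => by
    rw [osum (fun u u' => u * u') p q h]; ring
  have hdI : t * t + (l - 1) * (δ * δ) ∈ I :=
    C.hdown _ hz _ (by nlinarith [mul_pos hδ0 hδ0]) hδ2.le
  have htδ : t * δ ∈ I := C.hdown _ hx _ (by positivity) (by nlinarith)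
  have ga : g (t * t) = c * (t * t) := hlin _ hx (by positivity)
  have gb : g (t * δ) = c * (t * δ) := hlin _ htδ (by positivity)
  have gd : g (t * t + (l - 1) * (δ * δ)) = c * (t * t + (l - 1) * (δ * δ)) :=
    hlin _ hdI (by nlinarith [mul_pos hδ0 hδ0])
  obtain ⟨y, hy, hy'⟩ := star_schur C.h0 C.H C.hkn C.hg C.hle t w
    (by rw [ga]; positivity) hx
    (by
      intro p i
      simp only [w]
      split_ifs
      · exact hsym _ hx _ (by simp)
      · exact htδ)
    (by
      intro p q
      by_cases hpq : p = q
      · subst hpq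
        rw [diag]; exact hdI
      · rw [offd p q hpq]
        exact hsym _ hvI _ (by simp))
  set σ : ℝ := g (t * t) * g (-v) - (2 * (g (-(t * t)) * g (t * δ)) + (l - 2) * g (t * δ) ^ 2)
    with hσ
  have hσ0 : σ ≠ 0 := by
    rw [hσ, hbad, ga, gb]
    rcases sq v hvI hv0 with h | h
    · rw [h, hv]
      have : c * (t * t) * (c * (2 * t * δ - (l - 2) * (δ * δ))) - (2 * (c * (t * t) * (c * (t * δ)))
        + (l - 2) * (c * (t * δ)) ^ 2) = - (2 * (l - 2) * (c * t * δ) ^ 2) := by ring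
      rw [this]
      have : (0:ℝ) < l - 2 := by linarith
      have : c * t * δ ≠ 0 := by positivity
      exact neg_ne_zero.2 (by positivity)
    · rw [h, hv]
      have : c * (t * t) * (-(c * (2 * t * δ - (l - 2) * (δ * δ)))) -
        (2 * (c * (t * t) * (c * (t * δ)))
        + (l - 2) * (c * (t * δ)) ^ 2) = - (4 * (c * t) ^ 2 * (t * δ)) := by ring
      rw [this]
      exact neg_ne_zero.2 (by positivity)
  have hS : ∀ p, ∑ q, y q - y p = 0 := by
    intro p
    have h1 := hy' p
    rw [← Finset.add_sum_erase _ _ (Finset.mem_univ p),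
      Finset.sum_congr rfl (g := fun q => σ * y q)
      (fun q hq => by
        have hne := (Finset.ne_of_mem_erase hq).symm
        rw [offd p q hne, osum (fun u u' => g (t * u) * g (t * u')) p q hne, mul_neg, hσ]
        ring), diag, dsum (fun u => g (t * u) * g (t * u)), mul_neg, hbad, gb, gd, ga,
        ← Finset.mul_sum] at h1
    have h2 : σ * ∑ q ∈ Finset.univ.erase p, y q = 0 := by linear_combination h1
    have h3 := (mul_eq_zero.1 h2).resolve_left hσ0
    rw [← Finset.add_sum_erase _ _ (Finset.mem_univ p), h3]
    ring
  have hy1 : ∀ p, y p = ∑ q, y q := fun p => by linarith [hS p]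
  have hT : ∑ q, y q = e * ∑ q, y q := by
    conv_lhs => rw [Finset.sum_congr rfl (fun q _ => hy1 q)]
    simp
  have he : (2:ℝ) ≤ e := by exact_mod_cast C.he2
  have hT0 : ∑ q, y q = 0 := by
    have : ((e:ℝ) - 1) * ∑ q, y q = 0 := by linarith
    exact (mul_eq_zero.1 this).resolve_left (by linarith)
  apply hy
  ext p
  rw [hy1 p, hT0]; rfl

lemma affine (C : Ctx n k l e I f g)
    (hI : (∀ x ∈ I, 0 ≤ x) ∨ ∀ x ∈ I, ∀ y, |y| ≤ |x| → y ∈ I) :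
    ∃ c, ∀ x ∈ I, f x = f 0 + c * x := by
  obtain ⟨c, hc⟩ := C.lin_pos
  refine ⟨c, fun x hx => ?_⟩
  suffices h : g x = c * x by
    rw [C.hg] at h; linarith
  rcases le_or_gt 0 x with h | h
  · exact hc x hx h
  rcases hI with hI | hI
  · exact absurd (hI x hx) (by linarith)
  have hnx : -x ∈ I := hI x hx _ (by simp)
  by_cases hc0 : c = 0
  · have := C.neg_zero_case hI (fun x hx h => by rw [hc x hx h, hc0, zero_mul])
      (x := -x) (by linarith) hnx
    rw [neg_neg] at this
    rw [this, hc0, zero_mul]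
  · have := C.neg_case hI hc0 hc (x := -x) (by linarith) hnx
    rw [neg_neg] at this
    rw [this]; ring

end Ctx

lemma interval_facts (R : EReal) (hR : 0 < R) (I : Set ℝ)
    (hI : I = {x : ℝ | 0 ≤ x ∧ (x : EReal) < R} ∨
          I = {x : ℝ | -R < (x : EReal) ∧ (x : EReal) < R}) :
    (0:ℝ) ∈ I ∧ (∀ x ∈ I, ∀ y, 0 ≤ y → y ≤ x → y ∈ I) ∧ (∀ x ∈ I, ∃ z ∈ I, x < z) ∧
    ((∀ x ∈ I, 0 ≤ x) ∨ ∀ x ∈ I, ∀ y, |y| ≤ |x| → y ∈ I) := by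
  have hnR : -R < 0 := by rw [EReal.neg_lt_comm]; simpa using hR
  rcases hI with rfl | rfl
  · refine ⟨⟨le_rfl, by simpa using hR⟩, ?_, ?_, Or.inl fun x hx => hx.1⟩
    · rintro x ⟨_, hx⟩ y hy hyx
      exact ⟨hy, lt_of_le_of_lt (EReal.coe_le_coe_iff.2 hyx) hx⟩
    · rintro x ⟨h, hx⟩
      obtain ⟨z, h1, h2⟩ := EReal.lt_iff_exists_real_btwn.1 hx
      have := EReal.coe_lt_coe_iff.1 h1
      exact ⟨z, ⟨by linarith, h2⟩, this⟩
  · have hs : ∀ x : ℝ, (-R < (x:EReal) ∧ (x:EReal) < R) → ∀ y : ℝ, |y| ≤ |x| →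
        (-R < (y:EReal) ∧ (y:EReal) < R) := by
      rintro x ⟨h1, h2⟩ y hy
      have h3 : ((|x| : ℝ) : EReal) < R := by
        rcases abs_choice x with h | h
        · rwa [h]
        · rw [h, EReal.coe_neg]; rwa [EReal.neg_lt_comm]
      have h4 : ((|y| : ℝ) : EReal) < R := lt_of_le_of_lt (EReal.coe_le_coe_iff.2 hy) h3
      constructor
      · rw [EReal.neg_lt_comm, ← EReal.coe_neg]
        exact lt_of_le_of_lt (EReal.coe_le_coe_iff.2 (neg_le_abs y)) h4
      · exact lt_of_le_of_lt (EReal.coe_le_coe_iff.2 (le_abs_self y)) h4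
    refine ⟨⟨by simpa using hnR, by simpa using hR⟩, ?_, ?_, Or.inr hs⟩
    · intro x hx y hy hyx
      exact hs x hx y (by rw [abs_of_nonneg hy]; exact hyx.trans (le_abs_self x))
    · rintro x ⟨h, hx⟩
      obtain ⟨z, h1, h2⟩ := EReal.lt_iff_exists_real_btwn.1 hx
      exact ⟨z, ⟨h.trans h1, h2⟩, EReal.coe_lt_coe_iff.1 h1⟩

lemma map_affine {n : ℕ} {I : Set ℝ} {f : ℝ → ℝ} {c : ℝ} (hc : ∀ x ∈ I, f x = f 0 + c * x)
    (A : Matrix (Fin n) (Fin n) ℝ) (hA : ∀ i j, A i j ∈ I) :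
    A.map f = f 0 • Matrix.vecMulVec (fun _ => 1) (fun _ => 1) + c • A := by
  ext i j
  simp [hc _ (hA i j), Matrix.vecMulVec_apply]

lemma rank_smul_le_aux {n : ℕ} (c : ℝ) (A : Matrix (Fin n) (Fin n) ℝ) :
    (c • A).rank ≤ A.rank := by
  have : c • A = (c • (1 : Matrix (Fin n) (Fin n) ℝ)) * A := by simp
  rw [this]
  exact Matrix.rank_mul_le_right _ _

lemma rank_affine {n k l : ℕ} {I : Set ℝ} {f : ℝ → ℝ} {c : ℝ} (hlk : l < k)
    (hc : ∀ x ∈ I, f x = f 0 + c * x)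
    (A : Matrix (Fin n) (Fin n) ℝ) (hr : A.rank ≤ l) (hA : ∀ i j, A i j ∈ I) :
    (A.map f).rank ≤ k := by
  rw [map_affine hc A hA]
  have h1 := rank_add_le_aux (f 0 • Matrix.vecMulVec (fun _ : Fin n => (1:ℝ)) (fun _ => 1)) (c • A)
  have h2 := rank_smul_le_aux (f 0) (Matrix.vecMulVec (fun _ : Fin n => (1:ℝ)) (fun _ => 1))
  have h3 := Matrix.rank_vecMulVec_le (fun _ : Fin n => (1:ℝ)) (fun _ : Fin n => (1:ℝ))
  have h4 := rank_smul_le_aux c A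
  omega

lemma psd_affine {n : ℕ} {I : Set ℝ} {f : ℝ → ℝ} {c : ℝ} (h0 : 0 ≤ f 0) (hc0 : 0 ≤ c)
    (hc : ∀ x ∈ I, f x = f 0 + c * x)
    (A : Matrix (Fin n) (Fin n) ℝ) (hP : A.PosSemidef) (hA : ∀ i j, A i j ∈ I) :
    (A.map f).PosSemidef := by
  rw [map_affine hc A hA]
  refine Matrix.PosSemidef.add (Matrix.PosSemidef.smul ?_ h0) (hP.smul hc0)
  simpa using Matrix.posSemidef_vecMulVec_self_star (fun _ : Fin n => (1:ℝ))

lemma main_rank (R : EReal) (hR : 0 < R) (n k l : ℕ)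
    (hl : 2 < l) (hlk : l < k) (hk2l : k < 2 * l) (hkn : k < n - 1)
    (I : Set ℝ)
    (hI : I = {x : ℝ | 0 ≤ x ∧ (x : EReal) < R} ∨
          I = {x : ℝ | -R < (x : EReal) ∧ (x : EReal) < R})
    (f : ℝ → ℝ) (H : RkHyp n k l I f) : ∃ c₁ : ℝ, ∀ x ∈ I, f x = f 0 + c₁ * x := by
  obtain ⟨i0, i1, i2, i3⟩ := interval_facts R hR I hI
  have C : Ctx n k l (k + 1 - l) I f (fun x => f x - f 0) :=
    ⟨i0, i1, i2, H, by omega, fun _ => rfl, by omega, by omega, by omega, by omega⟩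
  exact C.affine i3

lemma main_psd (R : EReal) (hR : 0 < R) (n k l : ℕ)
    (hl : 2 < l) (hlk : l < k) (hk2l : k < 2 * l) (hkn : k < n - 1)
    (I : Set ℝ)
    (hI : I = {x : ℝ | 0 ≤ x ∧ (x : EReal) < R} ∨
          I = {x : ℝ | -R < (x : EReal) ∧ (x : EReal) < R})
    (f : ℝ → ℝ) :
    (∀ A : Matrix (Fin n) (Fin n) ℝ, A.PosSemidef → A.rank ≤ l → (∀ i j, A i j ∈ I) →
        (A.map f).PosSemidef ∧ (A.map f).rank ≤ k) ↔
      (0 ≤ f 0 ∧ ∃ c₁ : ℝ, 0 ≤ c₁ ∧ ∀ x ∈ I, f x = f 0 + c₁ * x) := by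
  constructor
  · intro H
    obtain ⟨i0, i1, i2, i3⟩ := interval_facts R hR I hI
    obtain ⟨c, hc⟩ := main_rank R hR n k l hl hlk hk2l hkn I hI f
      (fun A h1 h2 h3 => (H A h1 h2 h3).2)
    obtain ⟨x, hx, hx0⟩ := i2 0 i0
    let a : Fin n := ⟨0, by omega⟩
    let b : Fin n := ⟨1, by omega⟩
    have hab : a ≠ b := by simp [a, b]
    refine ⟨?_, c, ?_, hc⟩
    · have := (H 0 Matrix.PosSemidef.zero (by simp) (by intro i j; simpa using i0)).1.diag_nonneg (i := a)
      simpa using this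
    · have hP := (H (Matrix.diagonal (Pi.single a x))
        (Matrix.PosSemidef.diagonal (by
          intro i
          by_cases h : i = a
          · subst h; simpa using hx0.le
          · simp [h]))
        (by
          have e : Matrix.diagonal (Pi.single a x) =
              Matrix.vecMulVec (Pi.single a x) (Pi.single a (1:ℝ)) := by
            ext i j
            by_cases hi : i = a <;> by_cases hj : j = a <;>
              simp [Matrix.diagonal_apply, Matrix.vecMulVec_apply, Pi.single_apply, hi, hj] <;>
              grind
          rw [e]
          exact (Matrix.rank_vecMulVec_le _ _).trans (by omega))
        (by
          intro i j
          rw [Matrix.diagonal_apply]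
          split_ifs
          · by_cases h : i = a
            · subst h; simpa using hx
            · simpa [h] using i0
          · exact i0)).1
      have q := hP.dotProduct_mulVec_nonneg (Pi.single a 1 - Pi.single b 1)
      simp [Matrix.mulVec_sub, sub_dotProduct, hab, hab.symm] at q
      have := hc x hx
      have h : 0 ≤ c * x := by linarith
      exact nonneg_of_mul_nonneg_left h hx0
  · rintro ⟨h0, c, hc0, hc⟩ A hP hr hA
    exact ⟨psd_affine h0 hc0 hc A hP hA, rank_affine hlk hc A hr hA⟩

theorem affine_linear_regime
    (R : EReal) (hR : 0 < R) (n k l : ℕ)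
    (hl : 2 < l) (hlk : l < k) (hk2l : k < 2 * l) (hkn : k < n - 1)
    (I : Set ℝ)
    (hI : I = {x : ℝ | 0 ≤ x ∧ (x : EReal) < R} ∨
          I = {x : ℝ | -R < (x : EReal) ∧ (x : EReal) < R})
    (f : ℝ → ℝ) (hf : ContinuousOn f I) :
    ((∀ A : Matrix (Fin n) (Fin n) ℝ, A.IsSymm → A.rank ≤ l → (∀ i j, A i j ∈ I) →
        (A.map f).IsSymm ∧ (A.map f).rank ≤ k) ↔
      (∃ c₁ : ℝ, ∀ x ∈ I, f x = f 0 + c₁ * x)) ∧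
    ((∀ A : Matrix (Fin n) (Fin n) ℝ, A.PosSemidef → A.rank ≤ l → (∀ i j, A i j ∈ I) →
        (A.map f).IsSymm ∧ (A.map f).rank ≤ k) ↔
      (∃ c₁ : ℝ, ∀ x ∈ I, f x = f 0 + c₁ * x)) ∧
    ((∀ A : Matrix (Fin n) (Fin n) ℝ, A.PosSemidef → A.rank ≤ l → (∀ i j, A i j ∈ I) →
        (A.map f).PosSemidef ∧ (A.map f).rank ≤ k) ↔
      (0 ≤ f 0 ∧ ∃ c₁ : ℝ, 0 ≤ c₁ ∧ ∀ x ∈ I, f x = f 0 + c₁ * x)) ∧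
    (I = {x : ℝ | 0 ≤ x ∧ (x : EReal) < R} → k ≤ n - 3 →
      ∀ g : ℝ → ℝ,
        ((∀ A : Matrix (Fin n) (Fin n) ℝ, A.PosSemidef → A.rank ≤ l → (∀ i j, A i j ∈ I) →
            (A.map g).PosSemidef ∧ (A.map g).rank ≤ k) ↔
          (0 ≤ g 0 ∧ ∃ c₁ : ℝ, 0 ≤ c₁ ∧ ∀ x ∈ I, g x = g 0 + c₁ * x))) := by

  have rev : (∃ c₁ : ℝ, ∀ x ∈ I, f x = f 0 + c₁ * x) →
      ∀ A : Matrix (Fin n) (Fin n) ℝ, A.IsSymm → A.rank ≤ l → (∀ i j, A i j ∈ I) →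
        (A.map f).IsSymm ∧ (A.map f).rank ≤ k := by
    rintro ⟨c, hc⟩ A hs hr hA
    exact ⟨hs.map f, rank_affine hlk hc A hr hA⟩
  have hsym : ∀ A : Matrix (Fin n) (Fin n) ℝ, A.PosSemidef → A.IsSymm := by
    intro A hA
    have := hA.isHermitian
    simpa [Matrix.IsHermitian, Matrix.IsSymm] using this
  have fwd : (∀ A : Matrix (Fin n) (Fin n) ℝ, A.PosSemidef → A.rank ≤ l → (∀ i j, A i j ∈ I) →
        (A.map f).IsSymm ∧ (A.map f).rank ≤ k) → (∃ c₁ : ℝ, ∀ x ∈ I, f x = f 0 + c₁ * x) :=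
    fun H => main_rank R hR n k l hl hlk hk2l hkn I hI f (fun A h1 h2 h3 => (H A h1 h2 h3).2)
  refine ⟨⟨fun H => fwd fun A h => H A (hsym A h), rev⟩,
    ⟨fwd, fun h A hA => rev h A (hsym A hA)⟩,
    main_psd R hR n k l hl hlk hk2l hkn I hI f,
    fun _ _ g => main_psd R hR n k l hl hlk hk2l hkn I hI g⟩
end
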